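/- arXiv:1505.08044 — 4 statements merged into one kernel-verified Lean document; each statement's English description precedes it below -/
import Mathlib

section
/- For every integer k ≥ 1 and every p ∈ (0,1), the set H_{k,p} of independence p-densities of countable hypergraphs of rank at most k is a closed subset of ℝ, and moreover H_{k,p} = {0} ∪ {id_p(H) : H is a finite hypergraph with r(H) ≤ k}. -/
open Filter Topology

/-- A finite hypergraph with vertices in `ℕ`: a finite vertex set together with a
finite collection of hyperedges (finite sets of vertices). -/
structure FinHG where
  verts : Finset ℕ
  edges : Finset (Finset ℕ)

namespace FinHG

/-- A finite hypergraph is valid if every hyperedge is a nonempty subset of the vertex set. -/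
def Valid (H : FinHG) : Prop :=
  ∀ e ∈ H.edges, e.Nonempty ∧ e ⊆ H.verts

/-- `I` is an independent set of `H`: it contains no hyperedge. -/
def Indep (H : FinHG) (I : Finset ℕ) : Prop :=
  ∀ e ∈ H.edges, ¬ e ⊆ I

/-- The independence `p`-density of a finite hypergraph:
`∑_{I independent} p^|I| (1-p)^(|V| - |I|)`. -/
noncomputable def idp (H : FinHG) (p : ℝ) : ℝ :=
  ∑ I ∈ H.verts.powerset.filter fun I => ∀ e ∈ H.edges, ¬ e ⊆ I,
    p ^ I.card * (1 - p) ^ (H.verts.card - I.card)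

/-- The rank of a finite hypergraph: the supremum of the sizes of its hyperedges. -/
def rank (H : FinHG) : ℕ := H.edges.sup Finset.card

/-- The induced subhypergraph on a set `W` of vertices. -/
def induced (H : FinHG) (W : Finset ℕ) : FinHG :=
  ⟨W, H.edges.filter fun e => e ⊆ W⟩

end FinHG

/-- A countable hypergraph: the vertex set is a subset of `ℕ` and the hyperedges are
finite sets of vertices. -/
structure HG where
  verts : Set ℕ
  edges : Set (Finset ℕ)

namespace HG

/-- A countable hypergraph is valid if every hyperedge is a nonempty subset of the
vertex set. -/
def Valid (H : HG) : Prop :=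
  ∀ e ∈ H.edges, e.Nonempty ∧ ↑e ⊆ H.verts

/-- The rank of `H` is at most `k`: every hyperedge has size at most `k`. -/
def RankLe (H : HG) (k : ℕ) : Prop := ∀ e ∈ H.edges, e.card ≤ k

/-- The rank of `H` (the supremum of the sizes of hyperedges) equals `k`. -/
def RankEq (H : HG) (k : ℕ) : Prop := H.RankLe k ∧ ∃ e ∈ H.edges, e.card = k

/-- A chain for a countable hypergraph `H`: an increasing sequence of finite
hypergraphs, each an induced subhypergraph of the next, whose vertex sets and
hyperedge sets union to those of `H`. -/
def IsChain (H : HG) (C : ℕ → FinHG) : Prop :=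
  (∀ n, ∀ e ∈ (C n).edges, e ⊆ (C n).verts) ∧
  (∀ n, (C n).verts ⊆ (C (n + 1)).verts) ∧
  (∀ n, (C n).edges = (C (n + 1)).edges.filter fun e => e ⊆ (C n).verts) ∧
  (⋃ n, ((C n).verts : Set ℕ)) = H.verts ∧
  (⋃ n, ((C n).edges : Set (Finset ℕ))) = H.edges

/-- `x` is the independence `p`-density of the countable hypergraph `H`: along every
chain for `H`, the independence `p`-densities converge to `x`. -/
def idpLim (H : HG) (p x : ℝ) : Prop :=
  ∀ C : ℕ → FinHG, H.IsChain C → Tendsto (fun n => (C n).idp p) atTop (𝓝 x)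

/-- The neighbourhood hypergraph of a set `A` of vertices:
`N_H(A) = {F ⊆ V(H) \ A : F ∪ A ∈ H}`. -/
def nbhd (H : HG) (A : Finset ℕ) : Set (Finset ℕ) :=
  {F | ↑F ⊆ H.verts \ ↑A ∧ F ∪ A ∈ H.edges}

end HG

/-- `H_{k,p}`: the set of independence `p`-densities of countable hypergraphs of rank
at most `k`. -/
def HkSet (k : ℕ) (p : ℝ) : Set ℝ :=
  {x | ∃ H : HG, H.Valid ∧ H.RankLe k ∧ H.idpLim p x}

/-- A collection `E` of finite sets contains a matching (pairwise disjoint nonempty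
members) of size at least `m`. -/
def HasMatching (E : Set (Finset ℕ)) (m : ℕ) : Prop :=
  ∃ M : Finset (Finset ℕ), ↑M ⊆ E ∧ (∀ e ∈ M, e.Nonempty) ∧
    (M : Set (Finset ℕ)).Pairwise Disjoint ∧ m ≤ M.card

/-- A collection `E` of finite sets contains an infinite matching: an infinite
collection of pairwise disjoint nonempty members. -/
def HasInfMatching (E : Set (Finset ℕ)) : Prop :=
  ∃ Y : ℕ → Finset ℕ, (∀ i, Y i ∈ E) ∧ (∀ i, (Y i).Nonempty) ∧
    ∀ i j, i ≠ j → Disjoint (Y i) (Y j)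

noncomputable section

/-- The expectation of `f` at a random subset of `V` that contains each vertex independently
with probability `p`. -/
def bernoulliSum (p : ℝ) (V : Finset ℕ) (f : Finset ℕ → ℝ) : ℝ :=
  ∑ I ∈ V.powerset, p ^ I.card * (1 - p) ^ (V.card - I.card) * f I

/-- The probability that a random subset of the vertices is independent and contains `A`. -/
def FinHG.indepWeight (H : FinHG) (p : ℝ) (A : Finset ℕ) : ℝ :=
  bernoulliSum p H.verts fun I => if A ⊆ I ∧ ∀ e ∈ H.edges, ¬ e ⊆ I then 1 else 0

section BernoulliSum

variable {p : ℝ} {V : Finset ℕ}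

theorem bernoulliSum_mono (hp0 : 0 ≤ p) (hp1 : p ≤ 1) {f g : Finset ℕ → ℝ}
    (h : ∀ I, f I ≤ g I) : bernoulliSum p V f ≤ bernoulliSum p V g := by
  have hq : 0 ≤ 1 - p := by linarith
  exact Finset.sum_le_sum fun I _ => mul_le_mul_of_nonneg_left (h I) (by positivity)

theorem bernoulliSum_add (f g : Finset ℕ → ℝ) :
    bernoulliSum p V (fun I => f I + g I) = bernoulliSum p V f + bernoulliSum p V g := by
  simp only [bernoulliSum, mul_add, Finset.sum_add_distrib]

theorem bernoulliSum_sum {ι : Type*} (s : Finset ι) (f : ι → Finset ℕ → ℝ) :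
    bernoulliSum p V (fun I => ∑ i ∈ s, f i I) = ∑ i ∈ s, bernoulliSum p V (f i) := by
  simp only [bernoulliSum, Finset.mul_sum]
  exact Finset.sum_comm

theorem bernoulliSum_const_mul (c : ℝ) (f : Finset ℕ → ℝ) :
    bernoulliSum p V (fun I => c * f I) = c * bernoulliSum p V f := by
  simp only [bernoulliSum, Finset.mul_sum]
  exact Finset.sum_congr rfl fun I _ => by ring

theorem bernoulliSum_superset {A : Finset ℕ} (hA : A ⊆ V) :
    bernoulliSum p V (fun I => if A ⊆ I then 1 else 0) = p ^ A.card := by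
  have h1 : V.powerset.filter (fun I => A ⊆ I) = (V \ A).powerset.image (A ∪ ·) := by
    rw [← Finset.Icc_eq_image_powerset hA]
    ext I
    simp [and_comm]
  simp only [bernoulliSum, mul_ite, mul_one, mul_zero]
  rw [← Finset.sum_filter, h1, Finset.sum_image]
  · have h2 : ∀ J ∈ (V \ A).powerset,
        p ^ (A ∪ J).card * (1 - p) ^ (V.card - (A ∪ J).card) =
          p ^ A.card * (p ^ J.card * (1 - p) ^ ((V \ A).card - J.card)) := by
      intro J hJ
      rw [Finset.mem_powerset] at hJ
      have hd : Disjoint A J := Finset.disjoint_of_subset_right hJ Finset.disjoint_sdiff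
      rw [Finset.card_union_of_disjoint hd, Finset.card_sdiff_of_subset hA, pow_add,
        Nat.sub_add_eq, mul_assoc]
    rw [Finset.sum_congr rfl h2, ← Finset.mul_sum, Finset.sum_pow_mul_eq_add_pow]
    simp
  · intro J hJ K hK h
    simp only [Finset.coe_powerset, Set.mem_preimage, Set.mem_powerset_iff,
      Finset.coe_subset] at hJ hK
    have hJ' : Disjoint A J := Finset.disjoint_of_subset_right hJ Finset.disjoint_sdiff
    have hK' : Disjoint A K := Finset.disjoint_of_subset_right hK Finset.disjoint_sdiff
    have := congrArg (· \ A) h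
    simpa [Finset.union_sdiff_distrib, Finset.sdiff_eq_self_of_disjoint hJ'.symm,
      Finset.sdiff_eq_self_of_disjoint hK'.symm] using this

theorem bernoulliSum_avoid {ι : Type*} [DecidableEq ι] (s : Finset ι) (F : ι → Finset ℕ)
    (hF : ∀ i ∈ s, F i ⊆ V) :
    bernoulliSum p V (fun I => if ∀ i ∈ s, ¬ F i ⊆ I then 1 else 0) =
      ∑ T ∈ s.powerset, (-1) ^ T.card * p ^ (T.biUnion F).card := by
  have h : ∀ I : Finset ℕ, (if ∀ i ∈ s, ¬ F i ⊆ I then (1 : ℝ) else 0) =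
      ∑ T ∈ s.powerset, (-1) ^ T.card * if T.biUnion F ⊆ I then 1 else 0 := by
    intro I
    rw [← Finset.prod_boole,
      Finset.prod_congr rfl fun i _ => show (if ¬ F i ⊆ I then (1 : ℝ) else 0) =
        -(if F i ⊆ I then 1 else 0) + 1 by split_ifs <;> simp_all,
      Finset.prod_add]
    refine Finset.sum_congr rfl fun T _ => ?_
    rw [Finset.prod_neg, Finset.prod_boole]
    simp
  simp only [h]
  rw [bernoulliSum_sum]
  refine Finset.sum_congr rfl fun T hT => ?_
  rw [bernoulliSum_const_mul, bernoulliSum_superset]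
  exact Finset.biUnion_subset.2 fun i hi => hF i (Finset.mem_powerset.1 hT hi)

theorem bernoulliSum_avoid_disjoint {ι : Type*} [DecidableEq ι] (s : Finset ι)
    (F : ι → Finset ℕ) (hF : ∀ i ∈ s, F i ⊆ V) (hd : (s : Set ι).PairwiseDisjoint F) :
    bernoulliSum p V (fun I => if ∀ i ∈ s, ¬ F i ⊆ I then 1 else 0) =
      ∏ i ∈ s, (1 - p ^ (F i).card) := by
  rw [bernoulliSum_avoid s F hF,
    Finset.prod_congr rfl fun i _ => show 1 - p ^ (F i).card = -p ^ (F i).card + 1 by ring,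
    Finset.prod_add]
  refine Finset.sum_congr rfl fun T hT => ?_
  rw [Finset.prod_neg, Finset.prod_pow_eq_pow_sum, Finset.card_biUnion]
  · simp
  · intro i hi j hj hij
    exact hd (Finset.mem_powerset.1 hT hi) (Finset.mem_powerset.1 hT hj) hij

theorem bernoulliSum_avoid_le (hp0 : 0 ≤ p) (hp1 : p ≤ 1) {ι : Type*} [DecidableEq ι] {k : ℕ}
    (s : Finset ι) (F : ι → Finset ℕ) (hF : ∀ i ∈ s, F i ⊆ V)
    (hd : (s : Set ι).PairwiseDisjoint F) (hk : ∀ i ∈ s, (F i).card ≤ k) :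
    bernoulliSum p V (fun I => if ∀ i ∈ s, ¬ F i ⊆ I then 1 else 0) ≤ (1 - p ^ k) ^ s.card := by
  rw [bernoulliSum_avoid_disjoint s F hF hd]
  rw [← Finset.prod_const]
  refine Finset.prod_le_prod (fun i _ => ?_) fun i hi => ?_
  · exact sub_nonneg.2 (pow_le_one₀ hp0 hp1)
  · exact sub_le_sub_left (pow_le_pow_of_le_one hp0 hp1 (hk i hi)) _

end BernoulliSum

namespace FinHG

variable {p : ℝ}

theorem idp_eq_bernoulliSum (H : FinHG) (p : ℝ) :
    H.idp p = bernoulliSum p H.verts fun I => if ∀ e ∈ H.edges, ¬ e ⊆ I then 1 else 0 := by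
  simp [idp, bernoulliSum, Finset.sum_filter]

theorem indepWeight_empty (H : FinHG) (p : ℝ) : H.indepWeight p ∅ = H.idp p := by
  simp [idp_eq_bernoulliSum, indepWeight]

theorem indepWeight_nonneg (hp0 : 0 ≤ p) (hp1 : p ≤ 1) (H : FinHG) (A : Finset ℕ) :
    0 ≤ H.indepWeight p A := by
  have h := bernoulliSum_mono (V := H.verts) hp0 hp1 (f := fun _ => 0)
    (g := fun I => if A ⊆ I ∧ ∀ e ∈ H.edges, ¬ e ⊆ I then 1 else 0)
    fun I => by split_ifs <;> norm_num
  simpa [bernoulliSum, indepWeight] using h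

theorem indepWeight_eq_zero_of_edge {H : FinHG} {e A : Finset ℕ} (he : e ∈ H.edges)
    (heA : e ⊆ A) : H.indepWeight p A = 0 := by
  have h : ∀ I, ¬ (A ⊆ I ∧ ∀ e ∈ H.edges, ¬ e ⊆ I) := fun I hI => hI.2 e he (heA.trans hI.1)
  simp [indepWeight, bernoulliSum, h]

theorem indepWeight_le_avoid_add_sum (hp0 : 0 ≤ p) (hp1 : p ≤ 1) {ι : Type*} (H : FinHG)
    (A : Finset ℕ) (s : Finset ι) (F : ι → Finset ℕ) :
    H.indepWeight p A ≤
      bernoulliSum p H.verts (fun I => if ∀ i ∈ s, ¬ F i ⊆ I then 1 else 0) +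
        ∑ i ∈ s, H.indepWeight p (A ∪ F i) := by
  simp only [indepWeight]
  rw [← bernoulliSum_sum, ← bernoulliSum_add]
  refine bernoulliSum_mono hp0 hp1 fun I => ?_
  have h0 : ∀ i ∈ s, (0 : ℝ) ≤ if A ∪ F i ⊆ I ∧ ∀ e ∈ H.edges, ¬ e ⊆ I then 1 else 0 :=
    fun i _ => by split_ifs <;> norm_num
  have hsum := Finset.sum_nonneg h0
  by_cases hs : ∀ i ∈ s, ¬ F i ⊆ I
  · rw [if_pos hs]
    split_ifs <;> linarith
  · rw [if_neg hs, zero_add]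
    split_ifs with hA
    · push Not at hs
      obtain ⟨i, hi, hFi⟩ := hs
      have h1 := Finset.single_le_sum h0 hi
      rwa [if_pos ⟨Finset.union_subset hA.1 hFi, hA.2⟩] at h1
    · exact hsum

theorem avoid_le_idp (hp0 : 0 ≤ p) (hp1 : p ≤ 1) {ι : Type*} (H : FinHG) (s : Finset ι)
    (F : ι → Finset ℕ) (h : ∀ e ∈ H.edges, ∃ i ∈ s, F i ⊆ e) :
    bernoulliSum p H.verts (fun I => if ∀ i ∈ s, ¬ F i ⊆ I then 1 else 0) ≤ H.idp p := by
  rw [idp_eq_bernoulliSum]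
  refine bernoulliSum_mono hp0 hp1 fun I => ?_
  have h1 : (∀ i ∈ s, ¬ F i ⊆ I) → ∀ e ∈ H.edges, ¬ e ⊆ I := fun hs e he heI =>
    have ⟨i, hi, hFi⟩ := h e he
    hs i hi (hFi.trans heI)
  split_ifs with h2 h3
  · rfl
  · exact absurd (h1 h2) h3
  · norm_num
  · rfl

theorem idp_le_avoid (hp0 : 0 ≤ p) (hp1 : p ≤ 1) {ι : Type*} (H : FinHG) (s : Finset ι)
    (F : ι → Finset ℕ) (h : ∀ i ∈ s, F i ∈ H.edges) :
    H.idp p ≤ bernoulliSum p H.verts (fun I => if ∀ i ∈ s, ¬ F i ⊆ I then 1 else 0) := by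
  have h1 := H.indepWeight_le_avoid_add_sum hp0 hp1 ∅ s F
  rwa [indepWeight_empty, Finset.sum_eq_zero, add_zero] at h1
  exact fun i hi => indepWeight_eq_zero_of_edge (h i hi) Finset.subset_union_right

theorem idp_nonneg (hp0 : 0 ≤ p) (hp1 : p ≤ 1) (H : FinHG) : 0 ≤ H.idp p :=
  H.indepWeight_empty p ▸ H.indepWeight_nonneg hp0 hp1 ∅

end FinHG

/-- An infinite family of sets of bounded size contains arbitrarily large sunflowers with a
common kernel that is contained in infinitely many members of the family. -/
theorem exists_sunflower_kernel {α : Type*} [DecidableEq α] {k : ℕ} {M : Set (Finset α)}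
    (hM : M.Infinite) (hk : ∀ B ∈ M, B.card ≤ k) :
    ∃ A : Finset α, {B ∈ M | A ⊆ B}.Infinite ∧ ∀ m : ℕ, ∃ s : Finset (Finset α),
      s.card = m ∧ (∀ B ∈ s, B ∈ M ∧ A ⊆ B) ∧
        (s : Set (Finset α)).PairwiseDisjoint fun B => B \ A := by
  classical
  let P : ℕ → Prop := fun j => ∃ A : Finset α, A.card = j ∧ {B ∈ M | A ⊆ B}.Infinite
  obtain ⟨A, hAcard, hA⟩ : P (Nat.findGreatest P k) :=
    Nat.findGreatest_spec (Nat.zero_le k) ⟨∅, by simpa using hM⟩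
  have hmax : ∀ v ∉ A, {B ∈ M | insert v A ⊆ B}.Finite := by
    intro v hv
    by_contra hinf
    obtain ⟨B, hBM, hB⟩ := Set.Infinite.nonempty hinf
    refine Nat.findGreatest_is_greatest (P := P) (n := k) (k := (insert v A).card) ?_
      ((Finset.card_le_card hB).trans (hk B hBM)) ⟨_, rfl, hinf⟩
    rw [Finset.card_insert_of_notMem hv, hAcard]
    exact Nat.lt_succ_self _
  refine ⟨A, hA, fun m => ?_⟩
  induction m with
  | zero => exact ⟨∅, by simp⟩
  | succ m ih =>
    obtain ⟨s, hcard, hs, hd⟩ := ih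
    have hfin : ((s : Set (Finset α)) ∪
        ⋃ v ∈ s.biUnion (· \ A), {B ∈ M | insert v A ⊆ B}).Finite := by
      refine s.finite_toSet.union (Set.Finite.biUnion (Finset.finite_toSet _) fun v hv => ?_)
      obtain ⟨C, -, hC⟩ := Finset.mem_biUnion.1 hv
      exact hmax v (Finset.mem_sdiff.1 hC).2
    obtain ⟨B, ⟨hBM, hAB⟩, hB⟩ := (hA.sdiff hfin).nonempty
    simp only [Set.mem_union, Set.mem_iUnion, not_or, not_exists, Finset.mem_coe] at hB
    refine ⟨insert B s, by rw [Finset.card_insert_of_notMem hB.1, hcard], ?_, ?_⟩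
    · rintro C hC
      rcases Finset.mem_insert.1 hC with rfl | hC
      exacts [⟨hBM, hAB⟩, hs C hC]
    · rw [Finset.coe_insert]
      refine hd.insert fun C hC _ => Finset.disjoint_left.2 fun v hvB hvC => ?_
      exact hB.2 v (Finset.mem_biUnion.2 ⟨C, hC, hvC⟩)
        ⟨hBM, Finset.insert_subset (Finset.mem_sdiff.1 hvB).1 hAB⟩

section Ultraproduct

variable {U : Ultrafilter ℕ}

theorem exists_coe_germ_eq (a : Germ (U : Filter ℕ) ℕ) :
    ∃ f : ℕ → ℕ, (f : Germ (U : Filter ℕ) ℕ) = a :=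
  Germ.inductionOn a fun f => ⟨f, rfl⟩

/-- A sequence representing a point of the ultrapower of `ℕ`. -/
def germRep (a : Germ (U : Filter ℕ) ℕ) : ℕ → ℕ :=
  (exists_coe_germ_eq a).choose

theorem coe_germRep (a : Germ (U : Filter ℕ) ℕ) : (germRep a : Germ (U : Filter ℕ) ℕ) = a :=
  (exists_coe_germ_eq a).choose_spec

/-- The `n`-th component of a finite set of points of the ultrapower of `ℕ`. -/
def germSlice (A : Finset (Germ (U : Filter ℕ) ℕ)) (n : ℕ) : Finset ℕ :=
  A.image fun a => germRep a n

theorem eventually_injOn_germ (W : Finset (Germ (U : Filter ℕ) ℕ)) :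
    ∀ᶠ n in (U : Filter ℕ), Set.InjOn (fun a : Germ (U : Filter ℕ) ℕ => germRep a n) W := by
  have h : ∀ᶠ n in (U : Filter ℕ), ∀ a ∈ W, ∀ b ∈ W, a ≠ b →
      germRep a n ≠ germRep b n := by
    simp only [Filter.eventually_all_finset, Filter.eventually_imp_distrib_left]
    intro a _ b _ hab
    refine Ultrafilter.eventually_not.2 fun heq => hab ?_
    rw [← coe_germRep a, ← coe_germRep b]
    exact Germ.coe_eq.2 heq
  filter_upwards [h] with n hn a ha b hb hab
  by_contra hne
  exact hn a ha b hb hne hab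

theorem germSlice_mono {A B : Finset (Germ (U : Filter ℕ) ℕ)} (h : A ⊆ B) (n : ℕ) :
    germSlice A n ⊆ germSlice B n :=
  Finset.image_subset_image h

/-- Every sequence of finite sets of bounded size is represented by a finite subset of the
ultrapower. -/
theorem exists_germSlice_eq {k : ℕ} {e : ℕ → Finset ℕ}
    (he : ∀ n, (e n).card ≤ k) : ∃ A : Finset (Germ (U : Filter ℕ) ℕ),
      A.card ≤ k ∧ ∀ᶠ n in (U : Filter ℕ), germSlice A n = e n := by
  classical
  induction k generalizing e with
  | zero => exact ⟨∅, by simp, .of_forall fun n => by simp_all [germSlice]⟩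
  | succ k ih =>
    rcases U.em fun n => (e n).Nonempty with h | h
    · let x : ℕ → ℕ := fun n => if hn : (e n).Nonempty then hn.choose else 0
      have hx : ∀ n, (e n).Nonempty → x n ∈ e n := fun n hn => by
        simpa only [x, dif_pos hn] using hn.choose_spec
      obtain ⟨A, hAc, hA⟩ := ih (e := fun n => if (e n).Nonempty then (e n).erase (x n) else ∅)
        fun n => by
          split_ifs with hn
          · rw [Finset.card_erase_of_mem (hx n hn)]
            have := he n
            omega
          · simp
      refine ⟨insert (x : Germ (U : Filter ℕ) ℕ) A, (Finset.card_insert_le _ _).trans (by omega),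
        ?_⟩
      have hrep : ∀ᶠ n in (U : Filter ℕ), germRep (x : Germ (U : Filter ℕ) ℕ) n = x n :=
        Germ.coe_eq.1 (coe_germRep (x : Germ (U : Filter ℕ) ℕ))
      filter_upwards [h, hA, hrep] with n hn hAn hrn
      rw [if_pos hn] at hAn
      rw [germSlice, Finset.image_insert, ← germSlice, hAn, hrn, Finset.insert_erase (hx n hn)]
    · refine ⟨∅, by simp, ?_⟩
      filter_upwards [h] with n hn
      simpa [germSlice, eq_comm] using hn

/-- A finite subset of the ultrapower is null for a sequence of hypergraphs if the probability
of containing it and being independent vanishes in the limit. -/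
def IsNullGerm (H : ℕ → FinHG) (p : ℝ) (A : Finset (Germ (U : Filter ℕ) ℕ)) : Prop :=
  (∀ᶠ n in (U : Filter ℕ), germSlice A n ⊆ (H n).verts) ∧
    Tendsto (fun n => (H n).indepWeight p (germSlice A n)) U (𝓝 0)

/-- The kernel of arbitrarily large sunflowers of null sets is null. -/
theorem IsNullGerm.of_sunflower {H : ℕ → FinHG} {p : ℝ} (hp0 : 0 < p) (hp1 : p < 1) {k : ℕ}
    [DecidableEq (Germ (U : Filter ℕ) ℕ)] {A : Finset (Germ (U : Filter ℕ) ℕ)}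
    (h : ∀ m : ℕ, ∃ s : Finset (Finset (Germ (U : Filter ℕ) ℕ)), s.card = m ∧
      (∀ B ∈ s, (IsNullGerm H p B ∧ B.card ≤ k) ∧ A ⊆ B) ∧
        (s : Set (Finset (Germ (U : Filter ℕ) ℕ))).PairwiseDisjoint fun B => B \ A) :
    IsNullGerm H p A := by
  refine ⟨?_, ?_⟩
  · obtain ⟨s, hs, hB, -⟩ := h 1
    obtain ⟨B, hBs⟩ := Finset.card_pos.1 (hs ▸ Nat.one_pos)
    filter_upwards [(hB B hBs).1.1.1] with n hn using (germSlice_mono (hB B hBs).2 n).trans hn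
  · rw [Metric.tendsto_nhds]
    intro ε hε
    obtain ⟨m, hm⟩ := exists_pow_lt_of_lt_one (half_pos hε)
      (show 1 - p ^ k < 1 from sub_lt_self _ (by positivity))
    obtain ⟨s, hs, hB, hd⟩ := h m
    have hsum : Tendsto (fun n => ∑ B ∈ s, (H n).indepWeight p (germSlice B n)) U (𝓝 0) := by
      simpa using tendsto_finsetSum s fun B hBs => (hB B hBs).1.1.2
    have hverts : ∀ᶠ n in (U : Filter ℕ), ∀ B ∈ s, germSlice B n ⊆ (H n).verts :=
      (Filter.eventually_all_finset s).2 fun B hBs => (hB B hBs).1.1.1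
    filter_upwards [hsum.eventually_lt_const (half_pos hε), hverts,
      eventually_injOn_germ (s.biUnion id)] with n h1 h2 h3
    have hw := (H n).indepWeight_le_avoid_add_sum hp0.le hp1.le (germSlice A n) s
      fun B => germSlice (B \ A) n
    have havoid := bernoulliSum_avoid_le (p := p) (V := (H n).verts) hp0.le hp1.le (k := k) s
      (fun B => germSlice (B \ A) n)
      (fun B hBs => (germSlice_mono Finset.sdiff_subset n).trans (h2 B hBs))
      (fun B hBs C hCs hBC => Finset.disjoint_left.2 fun v hvB hvC => by
        obtain ⟨b, hb, rfl⟩ := Finset.mem_image.1 hvB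
        obtain ⟨c, hc, hbc⟩ := Finset.mem_image.1 hvC
        have hcb : c = b := h3
          (Finset.mem_biUnion.2 ⟨C, hCs, (Finset.mem_sdiff.1 hc).1⟩)
          (Finset.mem_biUnion.2 ⟨B, hBs, (Finset.mem_sdiff.1 hb).1⟩) hbc
        exact Finset.disjoint_left.1 (hd hBs hCs hBC) hb (hcb ▸ hc))
      (fun B hBs => Finset.card_image_le.trans
        ((Finset.card_le_card Finset.sdiff_subset).trans (hB B hBs).1.2))
    have hunion : ∀ B ∈ s, germSlice A n ∪ germSlice (B \ A) n = germSlice B n := fun B hBs => by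
      rw [germSlice, germSlice, ← Finset.image_union,
        Finset.union_sdiff_of_subset (hB B hBs).2, germSlice]
    rw [Finset.sum_congr rfl fun B hBs => by rw [hunion B hBs]] at hw
    rw [hs] at havoid
    rw [Real.dist_0_eq_abs, abs_of_nonneg ((H n).indepWeight_nonneg hp0.le hp1.le _)]
    linarith

theorem finite_minimal_isNullGerm {H : ℕ → FinHG} {p : ℝ} (hp0 : 0 < p) (hp1 : p < 1) (k : ℕ) :
    {A : Finset (Germ (U : Filter ℕ) ℕ) | Minimal (IsNullGerm H p) A ∧ A.card ≤ k}.Finite := by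
  classical
  by_contra hinf
  obtain ⟨A, hA, hs⟩ := exists_sunflower_kernel hinf fun B hB => hB.2
  have hnull : IsNullGerm H p A := .of_sunflower hp0 hp1 fun m =>
    have ⟨s, hcard, hB, hd⟩ := hs m
    ⟨s, hcard, fun B hBs => ⟨⟨(hB B hBs).1.1.prop, (hB B hBs).1.2⟩, (hB B hBs).2⟩, hd⟩
  refine hA ((Set.finite_singleton A).subset ?_)
  rintro B ⟨hB, hAB⟩
  exact (hAB.antisymm (hB.1.2 hnull hAB)).symm

/-- A limit of independence densities of finite hypergraphs of bounded rank is either zero or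
the independence density of such a hypergraph. -/
theorem exists_idp_eq_of_tendsto {H : ℕ → FinHG} {p x : ℝ} (hp0 : 0 < p) (hp1 : p < 1) {k : ℕ}
    (hV : ∀ n, (H n).Valid) (hk : ∀ n, (H n).rank ≤ k)
    (hx : Tendsto (fun n => (H n).idp p) U (𝓝 x)) :
    x = 0 ∨ ∃ G : FinHG, G.Valid ∧ G.rank ≤ k ∧ G.idp p = x := by
  classical
  by_cases hempty : IsNullGerm H p (∅ : Finset (Germ (U : Filter ℕ) ℕ))
  · left
    refine tendsto_nhds_unique hx (hempty.2.congr fun n => ?_)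
    simp [germSlice, FinHG.indepWeight_empty]
  right
  set M := (finite_minimal_isNullGerm (U := U) (H := H) hp0 hp1 k).toFinset with hMdef
  have hM : ∀ A, A ∈ M ↔ Minimal (IsNullGerm H p) A ∧ A.card ≤ k := fun A => by simp [hMdef]
  have hcover : ∀ᶠ n in (U : Filter ℕ), ∀ e ∈ (H n).edges, ∃ A ∈ M, germSlice A n ⊆ e := by
    by_contra hcon
    rw [← Ultrafilter.eventually_not] at hcon
    push Not at hcon
    let e : ℕ → Finset ℕ := fun n =>
      if h : ∃ e ∈ (H n).edges, ∀ A ∈ M, ¬ germSlice A n ⊆ e then h.choose else ∅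
    have he : ∀ᶠ n in (U : Filter ℕ), e n ∈ (H n).edges ∧ ∀ A ∈ M, ¬ germSlice A n ⊆ e n := by
      filter_upwards [hcon] with n hn
      simpa only [e, dif_pos hn] using hn.choose_spec
    have hecard : ∀ n, (e n).card ≤ k := by
      intro n
      by_cases hn : ∃ e ∈ (H n).edges, ∀ A ∈ M, ¬ germSlice A n ⊆ e
      · simp only [e, dif_pos hn]
        exact (Finset.le_sup (f := Finset.card) hn.choose_spec.1).trans (hk n)
      · simp [e, dif_neg hn]
    obtain ⟨B, hBk, hB⟩ := exists_germSlice_eq (U := U) hecard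
    have hBnull : IsNullGerm H p B := by
      refine ⟨?_, tendsto_const_nhds.congr' ?_⟩
      · filter_upwards [he, hB] with n hn hBn using hBn ▸ (hV n _ hn.1).2
      · filter_upwards [he, hB] with n hn hBn
        rw [FinHG.indepWeight_eq_zero_of_edge hn.1 hBn.ge]
    obtain ⟨A, hAB, hA⟩ := exists_minimal_le_of_wellFoundedLT (IsNullGerm H p) B hBnull
    have hAM : A ∈ M := (hM A).2 ⟨hA, (Finset.card_le_card hAB).trans hBk⟩
    obtain ⟨n, hn, hBn⟩ := (he.and hB).exists
    exact hn.2 A hAM ((germSlice_mono hAB n).trans hBn.le)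
  have hverts : ∀ᶠ n in (U : Filter ℕ), ∀ A ∈ M, germSlice A n ⊆ (H n).verts :=
    (Filter.eventually_all_finset M).2 fun A hA => ((hM A).1 hA).1.prop.1
  let c : ℝ := ∑ T ∈ M.powerset, (-1) ^ T.card * p ^ (T.biUnion id).card
  have hc : ∀ᶠ n in (U : Filter ℕ), bernoulliSum p (H n).verts
      (fun I => if ∀ A ∈ M, ¬ germSlice A n ⊆ I then 1 else 0) = c := by
    filter_upwards [hverts, eventually_injOn_germ (M.biUnion id)] with n hn hinj
    rw [bernoulliSum_avoid M (germSlice · n) hn]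
    refine Finset.sum_congr rfl fun T hT => ?_
    have hTM : T.biUnion id ⊆ M.biUnion id :=
      Finset.biUnion_subset_biUnion_of_subset_left _ (Finset.mem_powerset.1 hT)
    rw [← Finset.card_image_of_injOn (hinj.mono (Finset.coe_subset.2 hTM)), Finset.biUnion_image]
    rfl
  have hsum : Tendsto (fun n => ∑ A ∈ M, (H n).indepWeight p (germSlice A n)) U (𝓝 0) := by
    simpa using tendsto_finsetSum M fun A hA => ((hM A).1 hA).1.prop.2
  have hxc : x = c := by
    refine le_antisymm ?_ ?_
    · refine le_of_tendsto_of_tendsto hx (by simpa using hsum.const_add c) ?_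
      filter_upwards [hc] with n hn
      have h := (H n).indepWeight_le_avoid_add_sum hp0.le hp1.le ∅ M (germSlice · n)
      simpa [hn, FinHG.indepWeight_empty] using h
    · refine ge_of_tendsto hx ?_
      filter_upwards [hc, hcover] with n hn hcov
      exact hn ▸ (H n).avoid_le_idp hp0.le hp1.le M (germSlice · n) hcov
  obtain ⟨n, hcn, hvn⟩ := (hc.and hverts).exists
  refine ⟨⟨(H n).verts, M.image (germSlice · n)⟩, ?_, ?_, ?_⟩
  · intro e he
    obtain ⟨A, hA, rfl⟩ := Finset.mem_image.1 he
    refine ⟨Finset.image_nonempty.2 (Finset.nonempty_iff_ne_empty.2 ?_), hvn A hA⟩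
    rintro rfl
    exact hempty ((hM ∅).1 hA).1.prop
  · refine Finset.sup_le fun e he => ?_
    obtain ⟨A, hA, rfl⟩ := Finset.mem_image.1 he
    exact Finset.card_image_le.trans ((hM A).1 hA).2
  · rw [FinHG.idp_eq_bernoulliSum, hxc, ← hcn]
    simp only [Finset.forall_mem_image]

end Ultraproduct

namespace HG

variable {H : HG} {C : ℕ → FinHG}

theorem IsChain.monotone_verts (h : H.IsChain C) : Monotone fun n => (C n).verts :=
  monotone_nat_of_le_succ h.2.1

theorem IsChain.monotone_edges (h : H.IsChain C) : Monotone fun n => (C n).edges :=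
  monotone_nat_of_le_succ fun n => (h.2.2.1 n).le.trans (Finset.filter_subset _ _)

theorem IsChain.eventually_mem_verts (h : H.IsChain C) {v : ℕ} (hv : v ∈ H.verts) :
    ∀ᶠ n in atTop, v ∈ (C n).verts := by
  rw [← h.2.2.2.1, Set.mem_iUnion] at hv
  obtain ⟨m, hm⟩ := hv
  filter_upwards [eventually_ge_atTop m] with n hn using h.monotone_verts hn hm

theorem IsChain.eventually_mem_edges (h : H.IsChain C) {e : Finset ℕ} (he : e ∈ H.edges) :
    ∀ᶠ n in atTop, e ∈ (C n).edges := by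
  rw [← h.2.2.2.2, Set.mem_iUnion] at he
  obtain ⟨m, hm⟩ := he
  filter_upwards [eventually_ge_atTop m] with n hn using h.monotone_edges hn hm

theorem IsChain.mem_edges (h : H.IsChain C) {n : ℕ} {e : Finset ℕ} (he : e ∈ (C n).edges) :
    e ∈ H.edges :=
  h.2.2.2.2 ▸ Set.mem_iUnion.2 ⟨n, he⟩

open scoped Classical in
/-- The chain of subhypergraphs induced on initial segments. -/
def initialChain (H : HG) (n : ℕ) : FinHG where
  verts := (Finset.range n).filter (· ∈ H.verts)
  edges := ((Finset.range n).filter (· ∈ H.verts)).powerset.filter (· ∈ H.edges)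

theorem isChain_initialChain (hH : H.Valid) : H.IsChain H.initialChain := by
  have hmono : ∀ n, (H.initialChain n).verts ⊆ (H.initialChain (n + 1)).verts := fun n => by
    classical
    exact Finset.filter_subset_filter _ (Finset.range_subset_range.2 n.le_succ)
  have hedge : ∀ n e, e ∈ (H.initialChain n).edges ↔
      e ⊆ (H.initialChain n).verts ∧ e ∈ H.edges := fun n e => by
    simp [initialChain]
  refine ⟨fun n e he => ((hedge n e).1 he).1, hmono, fun n => ?_, ?_, ?_⟩
  · ext e
    rw [Finset.mem_filter, hedge, hedge]
    exact ⟨fun he => ⟨⟨he.1.trans (hmono n), he.2⟩, he.1⟩, fun he => ⟨he.2, he.1.2⟩⟩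
  · ext v
    simp only [Set.mem_iUnion, initialChain, Finset.mem_coe, Finset.mem_filter, Finset.mem_range]
    exact ⟨fun ⟨_, hn⟩ => hn.2, fun hv => ⟨v + 1, v.lt_succ_self, hv⟩⟩
  · ext e
    simp only [Set.mem_iUnion, Finset.mem_coe, hedge]
    refine ⟨fun ⟨_, hn⟩ => hn.2, fun he => ⟨e.sup id + 1, fun v hv => ?_, he⟩⟩
    simp only [initialChain, Finset.mem_filter]
    exact ⟨Finset.mem_range.2
      (Nat.lt_succ_of_le (Finset.le_sup (f := id) hv)), (hH e he).2 hv⟩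

/-- A finite hypergraph regarded as a countable one. -/
def ofFin (G : FinHG) : HG := ⟨G.verts, G.edges⟩

theorem idpLim_ofFin {G : FinHG} (p : ℝ) : (ofFin G).idpLim p (G.idp p) := by
  intro C hC
  have hv : ∀ᶠ n in atTop, ∀ v ∈ G.verts, v ∈ (C n).verts :=
    (Filter.eventually_all_finset _).2 fun v hv => hC.eventually_mem_verts hv
  have he : ∀ᶠ n in atTop, ∀ e ∈ G.edges, e ∈ (C n).edges :=
    (Filter.eventually_all_finset _).2 fun e he => hC.eventually_mem_edges he
  refine tendsto_const_nhds.congr' ?_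
  filter_upwards [hv, he] with n hvn hen
  have h1 : (C n).verts = G.verts := by
    refine Finset.Subset.antisymm (fun v hvC => ?_) hvn
    have : v ∈ (ofFin G).verts := hC.2.2.2.1 ▸ Set.mem_iUnion.2 ⟨n, hvC⟩
    exact this
  have h2 : (C n).edges = G.edges :=
    Finset.Subset.antisymm (fun e heC => hC.mem_edges heC) hen
  rw [FinHG.idp, FinHG.idp, h1, h2]

/-- The hypergraph on `ℕ` whose hyperedges are all the singletons. -/
def singletons : HG := ⟨Set.univ, Set.range fun v => {v}⟩

theorem idpLim_singletons {p : ℝ} (hp0 : 0 < p) (hp1 : p < 1) : singletons.idpLim p 0 := by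
  intro C hC
  rw [Metric.tendsto_nhds]
  intro ε hε
  obtain ⟨m, hm⟩ := exists_pow_lt_of_lt_one hε (show 1 - p ^ 1 < 1 by simpa using hp0)
  have he : ∀ᶠ n in atTop, ∀ v ∈ Finset.range m, {v} ∈ (C n).edges :=
    (Filter.eventually_all_finset _).2 fun v _ => hC.eventually_mem_edges ⟨v, rfl⟩
  filter_upwards [he] with n hn
  have h1 := (C n).idp_le_avoid hp0.le hp1.le (Finset.range m) (fun v => {v}) hn
  have h2 := bernoulliSum_avoid_le (V := (C n).verts) hp0.le hp1.le (k := 1) (Finset.range m)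
    (fun v => {v}) (fun v hv => hC.1 n _ (hn v hv))
    (fun u _ v _ huv => by simpa using huv) (fun v _ => by simp)
  rw [Finset.card_range] at h2
  rw [Real.dist_0_eq_abs, abs_of_nonneg ((C n).idp_nonneg hp0.le hp1.le)]
  linarith

end HG

/-- The independence densities of finite hypergraphs of rank at most `k`, together with zero,
contain all limits of such densities. -/
theorem closure_finite_idp_subset {p : ℝ} (hp0 : 0 < p) (hp1 : p < 1) (k : ℕ) :
    closure {x : ℝ | ∃ H : FinHG, H.Valid ∧ H.rank ≤ k ∧ H.idp p = x} ⊆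
      {(0 : ℝ)} ∪ {x : ℝ | ∃ H : FinHG, H.Valid ∧ H.rank ≤ k ∧ H.idp p = x} := by
  intro x hx
  obtain ⟨y, hy, hyx⟩ := mem_closure_iff_seq_limit.1 hx
  choose H hV hk hH using hy
  refine exists_idp_eq_of_tendsto (U := hyperfilter ℕ) hp0 hp1 hV hk ?_
  simp only [hH]
  exact hyx.mono_left Nat.hyperfilter_le_atTop

end

/-- For every `k ≥ 1` and `p ∈ (0,1)`, the set `H_{k,p}` is closed and equals
`{0}` together with the set of independence `p`-densities of finite hypergraphs of
rank at most `k`. -/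
theorem stmt_0 (k : ℕ) (hk : 1 ≤ k) (p : ℝ) (hp0 : 0 < p) (hp1 : p < 1) :
    IsClosed (HkSet k p) ∧
      HkSet k p =
        {(0 : ℝ)} ∪ {x : ℝ | ∃ H : FinHG, H.Valid ∧ H.rank ≤ k ∧ H.idp p = x} := by
  have hset : HkSet k p =
      {(0 : ℝ)} ∪ {x : ℝ | ∃ H : FinHG, H.Valid ∧ H.rank ≤ k ∧ H.idp p = x} := by
    refine Set.Subset.antisymm ?_ ?_
    · rintro x ⟨H, hH, hk', hx⟩
      refine closure_finite_idp_subset hp0 hp1 k (mem_closure_of_tendsto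
        (hx _ (HG.isChain_initialChain hH)) (.of_forall fun n => ⟨_, ?_, ?_, rfl⟩))
      · exact fun e he => ⟨(hH e ((HG.isChain_initialChain hH).mem_edges he)).1,
          (HG.isChain_initialChain hH).1 n e he⟩
      · exact Finset.sup_le fun e he => hk' e ((HG.isChain_initialChain hH).mem_edges he)
    · rintro x (rfl | ⟨G, hG, hk', rfl⟩)
      · refine ⟨HG.singletons, ?_, ?_, HG.idpLim_singletons hp0 hp1⟩
        · rintro _ ⟨v, rfl⟩
          exact ⟨Finset.singleton_nonempty v, Set.subset_univ _⟩
        · rintro _ ⟨v, rfl⟩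
          simpa using hk
      · exact ⟨HG.ofFin G, fun e he => ⟨(hG e he).1, Finset.coe_subset.2 (hG e he).2⟩,
          fun e he => (Finset.le_sup (f := Finset.card) he).trans hk', HG.idpLim_ofFin p⟩
  refine ⟨?_, hset⟩
  rw [hset]
  refine isClosed_of_closure_subset ?_
  rw [closure_union, closure_singleton]
  exact Set.union_subset Set.subset_union_left (closure_finite_idp_subset hp0 hp1 k)
end

section
/- Let k ≥ 1, p ∈ (0,1), and let H be a countable hypergraph with rank r(H) ≤ k such that id_p(H) > 0. Then there exists a finite hypergraph H' with r(H') ≤ k and id_p(H') = id_p(H). -/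
open Filter Topology

section Sunflower

/-- An infinite family of finite sets of bounded size contains an infinite sunflower: a sequence
of members properly containing a common kernel `A`, any two of which meet exactly in `A`. -/
theorem exists_infinite_sunflower {k : ℕ} {F : Set (Finset ℕ)} (hF : F.Infinite)
    (hk : ∀ e ∈ F, e.card ≤ k) :
    ∃ (A : Finset ℕ) (Y : ℕ → Finset ℕ), (∀ i, Y i ∈ F ∧ A ⊂ Y i) ∧
      Pairwise fun i j => Disjoint (Y i \ A) (Y j \ A) := by
  let Q : ℕ → Prop := fun m => ∃ A : Finset ℕ, A.card = m ∧ {e ∈ F | A ⊆ e}.Infinite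
  have hQ0 : Q 0 := ⟨∅, rfl, by simpa using hF⟩
  have hQle : ∀ m, Q m → m ≤ k := by
    rintro m ⟨A, rfl, hA⟩
    obtain ⟨e, he, hAe⟩ := hA.nonempty
    exact (Finset.card_le_card hAe).trans (hk e he)
  classical
  obtain ⟨A, hAcard, hA⟩ : Q (Nat.findGreatest Q k) :=
    Nat.findGreatest_spec (Nat.zero_le k) hQ0
  have hfin : ∀ v ∉ A, {e ∈ F | insert v A ⊆ e}.Finite := by
    intro v hv
    by_contra hinf
    have hQ : Q (A.card + 1) := ⟨insert v A, Finset.card_insert_of_notMem hv, hinf⟩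
    have := Nat.le_findGreatest (hQle _ hQ) hQ
    omega
  have hstep : ∀ T : Finset ℕ, ∃ e, (e ∈ F ∧ A ⊂ e) ∧ Disjoint T (e \ A) := by
    intro T
    have hbad : ((⋃ v ∈ T \ A, {e ∈ F | insert v A ⊆ e}) ∪ {A}).Finite := by
      refine Set.Finite.union ?_ (Set.finite_singleton A)
      refine Set.Finite.biUnion (T \ A).finite_toSet fun v hv => hfin v ?_
      exact (Finset.mem_sdiff.1 hv).2
    obtain ⟨e, ⟨heF, hAe⟩, hne⟩ := hA.exists_notMem_finite hbad
    simp only [Set.mem_union, Set.mem_iUnion, Set.mem_singleton_iff, not_or, not_exists] at hne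
    refine ⟨e, ⟨heF, hAe.ssubset_of_ne (Ne.symm hne.2)⟩, Finset.disjoint_left.2 ?_⟩
    intro v hvT hve
    obtain ⟨hve, hvA⟩ := Finset.mem_sdiff.1 hve
    exact hne.1 v (Finset.mem_sdiff.2 ⟨hvT, hvA⟩) ⟨heF, Finset.insert_subset hve hAe⟩
  have hsymm : Std.Symm fun e f : Finset ℕ => Disjoint (e \ A) (f \ A) := ⟨fun _ _ h => h.symm⟩
  obtain ⟨Y, hY, hdisj⟩ := exists_seq_of_forall_finset_exists' (fun e => e ∈ F ∧ A ⊂ e)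
    (fun e f => Disjoint (e \ A) (f \ A)) fun s _ => by
      obtain ⟨e, he, hd⟩ := hstep (s.sup id)
      refine ⟨e, he, fun f hf => hd.mono_left ?_⟩
      exact Finset.sdiff_subset.trans (Finset.le_sup (f := id) hf)
  exact ⟨A, Y, hY, hdisj⟩

end Sunflower

section RandomSet

open MeasureTheory ProbabilityTheory
open scoped ENNReal

/-- The sets of vertices containing no member of `E`. -/
def indepSets (E : Set (Finset ℕ)) : Set (Set ℕ) := {I | ∀ e ∈ E, ¬ (e : Set ℕ) ⊆ I}

theorem measurableSet_superset (e : Finset ℕ) : MeasurableSet {I : Set ℕ | (e : Set ℕ) ⊆ I} := by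
  have : {I : Set ℕ | (e : Set ℕ) ⊆ I} = ⋂ i ∈ e, {I : Set ℕ | i ∈ I} := by
    ext I
    simp [Set.subset_def]
  rw [this]
  exact e.measurableSet_biInter fun i _ => measurableSet_setOfPred.2 (measurable_set_mem i)

theorem measurableSet_indepSets (E : Set (Finset ℕ)) : MeasurableSet (indepSets E) := by
  have : indepSets E = ⋂ e ∈ E, {I : Set ℕ | (e : Set ℕ) ⊆ I}ᶜ := by
    ext I
    simp [indepSets]
  rw [this]
  exact MeasurableSet.biInter E.to_countable fun e _ => (measurableSet_superset e).compl

/-- The probability that a `q`-random set has a prescribed trace on a finite set. -/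
theorem setBernoulli_real_trace (q : unitInterval) {S W : Finset ℕ} (hSW : S ⊆ W) :
    (setBernoulli Set.univ q).real {I : Set ℕ | ∀ i ∈ W, i ∈ I ↔ i ∈ S} =
      (q : ℝ) ^ S.card * (1 - q : ℝ) ^ (W.card - S.card) := by
  have hset : ((fun P : ℕ → Prop => {i | P i}) ⁻¹' {I : Set ℕ | ∀ i ∈ W, i ∈ I ↔ i ∈ S}) =
      Set.pi (W : Set ℕ) fun i => {i ∈ S} := by
    ext P
    simp [Set.mem_pi]
  rw [measureReal_def, setBernoulli_apply', hset, Measure.infinitePi_pi _ (by simp)]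
  have hfac : ∀ i, ((unitInterval.toNNReal q • Measure.dirac (i ∈ (Set.univ : Set ℕ)) +
      unitInterval.toNNReal (unitInterval.symm q) • Measure.dirac False : Measure Prop)
        {i ∈ S}).toReal = if i ∈ S then (q : ℝ) else 1 - q := by
    intro i
    by_cases hi : i ∈ S <;> simp [hi]
  rw [ENNReal.toReal_prod, Finset.prod_congr rfl fun i _ => hfac i, Finset.prod_ite]
  simp [Finset.filter_mem_eq_inter, Finset.inter_eq_right.2 hSW, Finset.filter_notMem_eq_sdiff,
    Finset.card_sdiff_of_subset hSW]

theorem setBernoulli_real_superset (q : unitInterval) (e : Finset ℕ) :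
    (setBernoulli Set.univ q).real {I : Set ℕ | (e : Set ℕ) ⊆ I} = (q : ℝ) ^ e.card := by
  have h := setBernoulli_real_trace q (subset_refl e)
  simp only [Nat.sub_self, pow_zero, mul_one] at h
  rw [← h]
  congr 1
  ext I
  simp +contextual [Set.subset_def]

theorem setBernoulli_superset (q : unitInterval) (e : Finset ℕ) :
    setBernoulli Set.univ q {I : Set ℕ | (e : Set ℕ) ⊆ I} = ENNReal.ofReal q ^ e.card := by
  rw [← ENNReal.ofReal_pow q.2.1, ← setBernoulli_real_superset, ofReal_measureReal]

/-- The independence density is the probability that a random set is independent. -/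
theorem FinHG.idp_eq_setBernoulli_real (q : unitInterval) (C : FinHG) (hC : ∀ e ∈ C.edges, e ⊆ C.verts) :
    C.idp q = (setBernoulli Set.univ q).real (indepSets (C.edges : Set (Finset ℕ))) := by
  classical
  have hset : indepSets (C.edges : Set (Finset ℕ)) =
      ⋃ S ∈ C.verts.powerset.filter fun S => ∀ e ∈ C.edges, ¬ e ⊆ S,
        {I : Set ℕ | ∀ i ∈ C.verts, i ∈ I ↔ i ∈ S} := by
    ext I
    simp only [indepSets, Set.mem_ofPred_eq, Set.mem_iUnion, Finset.mem_filter,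
      Finset.mem_powerset, Finset.mem_coe, exists_prop]
    constructor
    · intro h
      refine ⟨C.verts.filter (· ∈ I), ⟨Finset.filter_subset _ _, fun e he hsub => h e he ?_⟩, ?_⟩
      · exact fun i hi => (Finset.mem_filter.1 (hsub hi)).2
      · simp +contextual
    · rintro ⟨S, ⟨-, hS⟩, hI⟩ e he hsub
      exact hS e he fun i hi => (hI i (hC e he hi)).1 (hsub hi)
  have hmeas : ∀ S : Finset ℕ, MeasurableSet {I : Set ℕ | ∀ i ∈ C.verts, i ∈ I ↔ i ∈ S} := by
    intro S
    have : {I : Set ℕ | ∀ i ∈ C.verts, i ∈ I ↔ i ∈ S} =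
        ⋂ i ∈ C.verts, {I : Set ℕ | i ∈ I ↔ i ∈ S} := by
      ext I
      simp
    rw [this]
    refine C.verts.measurableSet_biInter fun i _ => ?_
    exact measurableSet_setOfPred.2 ((measurable_set_mem i).iff measurable_const)
  rw [hset, measureReal_biUnion_finset ?_ fun S _ => hmeas S]
  · refine Finset.sum_congr rfl fun S hS => ?_
    rw [setBernoulli_real_trace q (Finset.mem_powerset.1 (Finset.mem_filter.1 hS).1)]
  · intro S hS T hT hne
    refine Set.disjoint_left.2 fun I hIS hIT => hne ?_
    have hS' := Finset.mem_powerset.1 (Finset.mem_filter.1 hS).1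
    have hT' := Finset.mem_powerset.1 (Finset.mem_filter.1 hT).1
    ext i
    exact ⟨fun hi => (hIT i (hS' hi)).1 ((hIS i (hS' hi)).2 hi),
      fun hi => (hIS i (hT' hi)).1 ((hIT i (hT' hi)).2 hi)⟩

open Classical in
/-- The subhypergraph of `H` induced on the vertices smaller than `n`. -/
noncomputable def HG.initialSegment (H : HG) (n : ℕ) : FinHG where
  verts := (Finset.range n).filter (· ∈ H.verts)
  edges := ((Finset.range n).filter (· ∈ H.verts)).powerset.filter (· ∈ H.edges)

theorem HG.mem_verts_initialSegment {H : HG} {n i : ℕ} :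
    i ∈ (H.initialSegment n).verts ↔ i < n ∧ i ∈ H.verts := by
  simp [initialSegment]

theorem HG.mem_edges_initialSegment {H : HG} (hH : H.Valid) {n : ℕ} {e : Finset ℕ} :
    e ∈ (H.initialSegment n).edges ↔ e ∈ H.edges ∧ ∀ i ∈ e, i < n := by
  simp only [initialSegment, Finset.mem_filter, Finset.mem_powerset, Finset.subset_iff,
    Finset.mem_range]
  constructor
  · exact fun h => ⟨h.2, fun i hi => (h.1 hi).1⟩
  · exact fun h => ⟨fun i hi => ⟨h.2 i hi, (hH e h.1).2 hi⟩, h.1⟩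

theorem HG.iUnion_edges_initialSegment {H : HG} (hH : H.Valid) :
    ⋃ n, ((H.initialSegment n).edges : Set (Finset ℕ)) = H.edges := by
  ext e
  simp only [Set.mem_iUnion, Finset.mem_coe, mem_edges_initialSegment hH]
  constructor
  · rintro ⟨n, h⟩
    exact h.1
  · intro h
    exact ⟨e.sup id + 1, h, fun i hi => Nat.lt_succ_of_le (Finset.le_sup (f := id) hi)⟩

theorem HG.isChain_initialSegment {H : HG} (hH : H.Valid) : H.IsChain H.initialSegment := by
  refine ⟨fun n e he => ?_, fun n i hi => ?_, fun n => ?_, ?_, iUnion_edges_initialSegment hH⟩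
  · obtain ⟨he, hlt⟩ := (mem_edges_initialSegment hH).1 he
    exact fun i hi => mem_verts_initialSegment.2 ⟨hlt i hi, (hH e he).2 hi⟩
  · rw [mem_verts_initialSegment] at hi ⊢
    exact ⟨by omega, hi.2⟩
  · ext e
    simp only [Finset.mem_filter, mem_edges_initialSegment hH]
    constructor
    · rintro ⟨he, hlt⟩
      refine ⟨⟨he, fun i hi => (hlt i hi).trans n.lt_succ_self⟩, fun i hi => ?_⟩
      exact mem_verts_initialSegment.2 ⟨hlt i hi, (hH e he).2 hi⟩
    · rintro ⟨⟨he, -⟩, hsub⟩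
      exact ⟨he, fun i hi => (mem_verts_initialSegment.1 (hsub hi)).1⟩
  · ext i
    simp only [Set.mem_iUnion, Finset.mem_coe, mem_verts_initialSegment]
    exact ⟨fun ⟨_, h⟩ => h.2, fun h => ⟨i + 1, i.lt_succ_self, h⟩⟩

theorem HG.eq_setBernoulli_real_of_idpLim (q : unitInterval) {H : HG} (hH : H.Valid) {x : ℝ}
    (hx : H.idpLim q x) : x = (setBernoulli Set.univ q).real (indepSets H.edges) := by
  refine tendsto_nhds_unique (hx _ (isChain_initialSegment hH)) ?_
  have hset : indepSets H.edges =
      ⋂ n, indepSets ((H.initialSegment n).edges : Set (Finset ℕ)) := by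
    rw [← iUnion_edges_initialSegment hH]
    ext I
    simp only [indepSets, Set.mem_ofPred_eq, Set.mem_iUnion, Set.mem_iInter]
    exact ⟨fun h n e he => h e ⟨n, he⟩, fun h e ⟨n, he⟩ => h n e he⟩
  have hanti : Antitone fun n => indepSets ((H.initialSegment n).edges : Set (Finset ℕ)) := by
    intro m n hmn I hI e he
    refine hI e ?_
    rw [Finset.mem_coe, mem_edges_initialSegment hH] at he ⊢
    exact ⟨he.1, fun i hi => (he.2 i hi).trans_le hmn⟩
  have hlim := tendsto_measure_iInter_atTop (μ := setBernoulli Set.univ q)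
    (fun n => (measurableSet_indepSets _).nullMeasurableSet) hanti
    ⟨0, measure_ne_top _ _⟩
  rw [← hset] at hlim
  refine ((ENNReal.tendsto_toReal (measure_ne_top _ _)).comp hlim).congr fun n => ?_
  exact (FinHG.idp_eq_setBernoulli_real q _ ((isChain_initialSegment hH).1 n)).symm

/-- A random set almost surely contains one of infinitely many disjoint sets of bounded size. -/
theorem ae_exists_subset_of_pairwise_disjoint {q : unitInterval} (hq : 0 < (q : ℝ)) {k : ℕ}
    {F : ℕ → Finset ℕ} (hcard : ∀ i, (F i).card ≤ k)
    (hF : Pairwise fun i j => Disjoint (F i) (F j)) :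
    ∀ᵐ I ∂setBernoulli Set.univ q, ∃ i, (F i : Set ℕ) ⊆ I := by
  set μ := setBernoulli (Set.univ : Set ℕ) q
  let s : ℕ → Set (Set ℕ) := fun i => {I | (F i : Set ℕ) ⊆ I}
  have hs : ∀ i, MeasurableSet (s i) := fun i => measurableSet_superset (F i)
  have hindep : iIndepSet s μ := by
    rw [iIndepSet_iff_meas_biInter hs]
    intro t
    have hset : ⋂ i ∈ t, s i = {I | ((t.biUnion F : Finset ℕ) : Set ℕ) ⊆ I} := by
      ext I
      simp [s]
    rw [hset, setBernoulli_superset, Finset.card_biUnion fun i _ j _ hij => hF hij,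
      ← Finset.prod_pow_eq_pow_sum]
    exact Finset.prod_congr rfl fun i _ => (setBernoulli_superset q (F i)).symm
  have hsum : ∑' i, μ (s i) = ∞ := by
    have hpos : ENNReal.ofReal q ^ k ≠ 0 := pow_ne_zero _ (ENNReal.ofReal_pos.2 hq).ne'
    refine top_le_iff.1 ?_
    rw [← ENNReal.tsum_const_eq_top_of_ne_zero (α := ℕ) hpos]
    refine ENNReal.tsum_le_tsum fun i => ?_
    rw [setBernoulli_superset]
    exact pow_le_pow_right_of_le_one' (ENNReal.ofReal_le_one.2 q.2.2) (hcard i)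
  have hae : ∀ᵐ I ∂μ, I ∈ limsup s atTop :=
    (mem_ae_iff_prob_eq_one (MeasurableSet.measurableSet_limsup hs)).2
      (measure_limsup_eq_one hs hindep hsum)
  filter_upwards [hae] with I hI
  rw [mem_limsup_iff_frequently_mem] at hI
  exact hI.exists

/-- The minimal sets among those of size at most `k` that almost no random set avoiding `E`
contains form a finite family. -/
theorem finite_minimal_null {q : unitInterval} (hq : 0 < (q : ℝ)) (k : ℕ) (E : Set (Finset ℕ)) :
    {A : Finset ℕ | Minimal (fun A : Finset ℕ => A.card ≤ k ∧
      ∀ᵐ I ∂setBernoulli Set.univ q, I ∈ indepSets E → ¬ (A : Set ℕ) ⊆ I) A}.Finite := by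
  by_contra hinf
  obtain ⟨A, Y, hY, hdisj⟩ := exists_infinite_sunflower hinf fun A hA => hA.1.1
  have hYcard : ∀ i, (Y i).card ≤ k := fun i => (hY i).1.1.1
  have hA : ∀ᵐ I ∂setBernoulli Set.univ q, I ∈ indepSets E → ¬ (A : Set ℕ) ⊆ I := by
    have hpetal := ae_exists_subset_of_pairwise_disjoint hq
      (fun i => (Finset.card_le_card Finset.sdiff_subset).trans (hYcard i)) hdisj
    filter_upwards [hpetal, ae_all_iff.2 fun i => (hY i).1.1.2] with I ⟨i, hi⟩ hI hIE hAI
    refine hI i hIE fun v hv => ?_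
    by_cases hvA : v ∈ A
    · exact hAI hvA
    · exact hi (Finset.mem_sdiff.2 ⟨hv, hvA⟩)
  have hlt := (hY 0).2
  exact hlt.2 ((hY 0).1.2 ⟨(Finset.card_le_card hlt.1).trans (hYcard 0), hA⟩ hlt.1)

/-- A family of sets of size at most `k` that a random set avoids with positive probability can be
replaced by a finite such family without changing this probability. -/
theorem exists_finset_indepSets_ae_eq {q : unitInterval} (hq : 0 < (q : ℝ)) {k : ℕ} {E : Set (Finset ℕ)}
    (hk : ∀ e ∈ E, e.card ≤ k) (hE : setBernoulli Set.univ q (indepSets E) ≠ 0) :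
    ∃ M : Finset (Finset ℕ), (∀ e ∈ M, e.Nonempty ∧ e.card ≤ k) ∧
      indepSets (M : Set (Finset ℕ)) =ᵐ[setBernoulli Set.univ q] indepSets E := by
  have hfin := finite_minimal_null hq k E
  refine ⟨hfin.toFinset, fun e he => ?_, ?_⟩
  · rw [Set.Finite.mem_toFinset] at he
    refine ⟨Finset.nonempty_iff_ne_empty.2 ?_, he.1.1⟩
    rintro rfl
    refine hE (measure_eq_zero_iff_ae_notMem.2 ?_)
    filter_upwards [he.1.2] with I hI hIE
    exact hI hIE (by simp)
  · have hM : ∀ᵐ I ∂setBernoulli Set.univ q, ∀ A ∈ hfin.toFinset,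
        I ∈ indepSets E → ¬ (A : Set ℕ) ⊆ I := by
      rw [Filter.eventually_all_finset]
      exact fun A hA => ((Set.Finite.mem_toFinset hfin).1 hA).1.2
    filter_upwards [hM] with I hI
    refine propext ⟨fun h e he hsub => ?_, fun h A hA => hI A hA h⟩
    obtain ⟨A, hAe, hA⟩ := exists_minimal_le_of_wellFoundedLT
      (fun A : Finset ℕ => A.card ≤ k ∧
        ∀ᵐ I ∂setBernoulli Set.univ q, I ∈ indepSets E → ¬ (A : Set ℕ) ⊆ I) e
      ⟨hk e he, ae_of_all _ fun I hI => hI e he⟩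
    exact h A (by simpa using hA) ((Finset.coe_subset.2 hAe).trans hsub)

end RandomSet

/-- If `H` is a countable hypergraph of rank at most `k` with positive independence
`p`-density `x`, then some finite hypergraph of rank at most `k` has independence
`p`-density exactly `x`. -/
theorem stmt_1 (k : ℕ) (hk : 1 ≤ k) (p : ℝ) (hp0 : 0 < p) (hp1 : p < 1)
    (H : HG) (hHval : H.Valid) (hHrank : H.RankLe k)
    (x : ℝ) (hx : H.idpLim p x) (hxpos : 0 < x) :
    ∃ H' : FinHG, H'.Valid ∧ H'.rank ≤ k ∧ H'.idp p = x := by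
  lift p to unitInterval using ⟨hp0.le, hp1.le⟩
  have hxE := HG.eq_setBernoulli_real_of_idpLim p hHval hx
  obtain ⟨M, hM, hae⟩ := exists_finset_indepSets_ae_eq hp0 hHrank fun h0 =>
    hxpos.ne' (by simpa [MeasureTheory.measureReal_def, h0] using hxE)
  have hsub : ∀ e ∈ M, e ⊆ M.sup id := fun e he => Finset.le_sup (f := id) he
  refine ⟨⟨M.sup id, M⟩, fun e he => ⟨(hM e he).1, hsub e he⟩,
    Finset.sup_le fun e he => (hM e he).2, ?_⟩
  rw [FinHG.idp_eq_setBernoulli_real p _ hsub, hxE]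
  exact MeasureTheory.measureReal_congr hae
end

section
/- For every integer k ≥ 1 and every p ∈ (0,1), the set H_{k,p} of independence p-densities of countable hypergraphs of rank at most k is a closed subset of ℝ. -/
open Filter Topology

namespace RandomSubset

open MeasureTheory ProbabilityTheory unitInterval

/-- The law of the indicator function of a random set of natural numbers which contains each
number independently with probability `p`. -/
noncomputable def law (p : I) : Measure (ℕ → Bool) :=
  Measure.infinitePi fun _ => bernoulliMeasure true false p

instance (p : I) : IsProbabilityMeasure (law p) := by
  unfold law; infer_instance

/-- The event that the random set contains no member of `E`. -/
def avoid (E : Set (Finset ℕ)) : Set (ℕ → Bool) := {ω | ∀ e ∈ E, ∃ v ∈ e, ω v = false}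

/-- The event that the random set meets `V` exactly in `B` (when `B ⊆ V`). -/
def trace (V B : Finset ℕ) : Set (ℕ → Bool) := {ω | ∀ v ∈ V, ω v = decide (v ∈ B)}

/-- The probability that the random set contains no member of `E`. -/
noncomputable def density (p : I) (E : Set (Finset ℕ)) : ℝ := (law p).real (avoid E)

/-- The σ-algebra generated by the coordinates in `S`. -/
abbrev coordSigma (S : Set ℕ) : MeasurableSpace (ℕ → Bool) :=
  ⨆ i ∈ S, MeasurableSpace.comap (fun ω : ℕ → Bool => ω i) inferInstance

theorem measurableSet_coordSigma_eval {S : Set ℕ} {v : ℕ} (hv : v ∈ S) (b : Bool) :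
    MeasurableSet[coordSigma S] {ω : ℕ → Bool | ω v = b} := by
  have h : MeasurableSpace.comap (fun ω : ℕ → Bool => ω v) inferInstance ≤ coordSigma S :=
    le_iSup₂_of_le (f := fun i (_ : i ∈ S) =>
      MeasurableSpace.comap (fun ω : ℕ → Bool => ω i) inferInstance) v hv le_rfl
  exact h _ ⟨{b}, trivial, rfl⟩

theorem coordSigma_le (S : Set ℕ) : coordSigma S ≤ MeasurableSpace.pi :=
  iSup₂_le fun i _ => (measurable_pi_apply i).comap_le

theorem measurableSet_coordSigma_avoid {S : Set ℕ} {E : Set (Finset ℕ)}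
    (h : ∀ e ∈ E, (e : Set ℕ) ⊆ S) : MeasurableSet[coordSigma S] (avoid E) := by
  have : avoid E = ⋂ e ∈ E, ⋃ v ∈ e, {ω : ℕ → Bool | ω v = false} := by
    ext ω; simp [avoid]
  rw [this]
  exact MeasurableSet.biInter E.to_countable fun e he =>
    Finset.measurableSet_biUnion e fun v hv => measurableSet_coordSigma_eval (h e he hv) _

theorem measurableSet_coordSigma_trace (V B : Finset ℕ) :
    MeasurableSet[coordSigma V] (trace V B) := by
  have : trace V B = ⋂ v ∈ V, {ω : ℕ → Bool | ω v = decide (v ∈ B)} := by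
    ext ω; simp [trace]
  rw [this]
  exact Finset.measurableSet_biInter V fun v hv => measurableSet_coordSigma_eval hv _

theorem measurableSet_avoid (E : Set (Finset ℕ)) : MeasurableSet (avoid E) :=
  coordSigma_le Set.univ _ (measurableSet_coordSigma_avoid fun _ _ => Set.subset_univ _)

theorem measurableSet_trace (V B : Finset ℕ) : MeasurableSet (trace V B) :=
  coordSigma_le _ _ (measurableSet_coordSigma_trace V B)

theorem law_real_inter (p : I) {S T : Set ℕ} (h : Disjoint S T) {A B : Set (ℕ → Bool)}
    (hA : MeasurableSet[coordSigma S] A) (hB : MeasurableSet[coordSigma T] B) :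
    (law p).real (A ∩ B) = (law p).real A * (law p).real B := by
  have h₁ : iIndepFun (fun (i : ℕ) (ω : ℕ → Bool) => ω i) (law p) :=
    iIndepFun_infinitePi (X := fun _ (b : Bool) => b) fun _ => measurable_id
  have h₂ := indep_iSup_of_disjoint (fun i => (measurable_pi_apply i).comap_le) h₁.iIndep h
  have h₃ := (Indep_iff _ _ _).1 h₂ A B hA hB
  simp [measureReal_def, h₃]

theorem law_real_trace (p : I) {V B : Finset ℕ} (h : B ⊆ V) :
    (law p).real (trace V B) = (p : ℝ) ^ B.card * (1 - p) ^ (V.card - B.card) := by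
  have h₁ : trace V B = Set.pi V fun v => {decide (v ∈ B)} := by
    ext ω; simp [trace, Set.pi]
  have h₂ (v : ℕ) : (bernoulliMeasure true false p {decide (v ∈ B)}).toReal =
      if v ∈ B then (p : ℝ) else 1 - p := by
    rw [← measureReal_def, bernoulliMeasure_real_apply _ (MeasurableSet.singleton _)]
    by_cases hv : v ∈ B <;> simp [hv]
  rw [measureReal_def, h₁, law, Measure.infinitePi_pi _ fun _ _ => MeasurableSet.singleton _,
    ENNReal.toReal_prod, Finset.prod_congr rfl fun v _ => h₂ v, Finset.prod_ite]
  simp only [Finset.prod_const]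
  rw [Finset.filter_mem_eq_inter, Finset.inter_eq_right.2 h, Finset.filter_notMem_eq_sdiff,
    Finset.card_sdiff_of_subset h]

theorem density_singleton (p : I) (e : Finset ℕ) :
    density p {e} = 1 - (p : ℝ) ^ e.card := by
  have : avoid {e} = (trace e e)ᶜ := by
    ext ω; simp +contextual [avoid, trace]
  rw [density, this, probReal_compl_eq_one_sub (measurableSet_trace e e),
    law_real_trace p subset_rfl]
  simp

theorem density_nonneg (p : I) (E : Set (Finset ℕ)) : 0 ≤ density p E := measureReal_nonneg

theorem density_le_one (p : I) (E : Set (Finset ℕ)) : density p E ≤ 1 := measureReal_le_one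

theorem density_anti (p : I) {E F : Set (Finset ℕ)} (h : E ⊆ F) : density p F ≤ density p E :=
  measureReal_mono fun _ hω e he => hω e (h he)

theorem density_eq_zero (p : I) {E : Set (Finset ℕ)} (h : ∅ ∈ E) : density p E = 0 := by
  have : avoid E = ∅ := by
    ext ω
    simp only [avoid, Set.mem_ofPred_eq, Set.mem_empty_iff_false, iff_false]
    intro hω
    simpa using hω ∅ h
  simp [density, this]

theorem density_empty (p : I) : density p ∅ = 1 := by
  simp [density, avoid]

theorem density_image_map (p : I) (f : ℕ ↪ ℕ) (E : Set (Finset ℕ)) :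
    density p (Finset.map f '' E) = density p E := by
  have h : (law p).map (fun ω i => ω (f i)) = law p :=
    Measure.map_infinitePi_infinitePi_of_inj f.injective
  have h' : avoid (Finset.map f '' E) = (fun (ω : ℕ → Bool) i => ω (f i)) ⁻¹' avoid E := by
    ext ω; simp [avoid]
  rw [density, h', ← map_measureReal_apply (by fun_prop) (measurableSet_avoid E), h, density]

/-- The members of `E` inside `B ∪ [t, ∞)`, with the part in `[0, t)` deleted and the rest shifted
down by `t`. -/
def contract (t : ℕ) (E : Set (Finset ℕ)) (B : Finset ℕ) : Set (Finset ℕ) :=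
  {F | ∃ C ⊆ B, C ∪ F.map (addRightEmbedding t) ∈ E}

theorem exists_eq_union_map (t : ℕ) (e : Finset ℕ) :
    ∃ F : Finset ℕ, e = e.filter (· < t) ∪ F.map (addRightEmbedding t) := by
  refine ⟨(e.filter (t ≤ ·)).image (· - t), ?_⟩
  ext v
  simp only [Finset.mem_union, Finset.mem_filter, Finset.mem_map, Finset.mem_image,
    addRightEmbedding_apply]
  constructor
  · intro hv
    rcases lt_or_ge v t with h | h
    · exact Or.inl ⟨hv, h⟩
    · exact Or.inr ⟨v - t, ⟨v, ⟨hv, h⟩, rfl⟩, by omega⟩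
  · rintro (h | ⟨_, ⟨u, ⟨hu, h⟩, rfl⟩, rfl⟩)
    · exact h.1
    · rwa [Nat.sub_add_cancel h]

theorem trace_inter_avoid (t : ℕ) (E : Set (Finset ℕ)) {B : Finset ℕ} (hB : B ⊆ Finset.range t) :
    trace (Finset.range t) B ∩ avoid E =
      trace (Finset.range t) B ∩
        avoid (Finset.map (addRightEmbedding t) '' contract t E B) := by
  ext ω
  refine and_congr_right fun hω => ⟨?_, ?_⟩
  · rintro h _ ⟨F, ⟨C, hC, hCF⟩, rfl⟩
    obtain ⟨v, hv, hv'⟩ := h _ hCF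
    rcases Finset.mem_union.1 hv with hv | hv
    · have := hω v (hB (hC hv))
      simp [hC hv, hv'] at this
    · exact ⟨v, hv, hv'⟩
  · intro h e he
    obtain ⟨F, hF⟩ := exists_eq_union_map t e
    by_cases hC : e.filter (· < t) ⊆ B
    · obtain ⟨v, hv, hv'⟩ := h _ ⟨F, ⟨_, hC, hF ▸ he⟩, rfl⟩
      exact ⟨v, hF ▸ Finset.mem_union_right _ hv, hv'⟩
    · obtain ⟨v, hv, hvB⟩ := Finset.not_subset.1 hC
      rw [Finset.mem_filter] at hv
      exact ⟨v, hv.1, by simpa [hvB] using hω v (Finset.mem_range.2 hv.2)⟩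

theorem pairwiseDisjoint_trace (V : Finset ℕ) (s : Set (Finset ℕ)) (hs : ∀ B ∈ s, B ⊆ V) :
    s.PairwiseDisjoint (trace V) := by
  intro B hB C hC hne
  refine Set.disjoint_left.2 fun ω h₁ h₂ => hne ?_
  ext v
  by_cases hv : v ∈ V
  · have := (h₁ v hv).symm.trans (h₂ v hv)
    simpa using this
  · exact iff_of_false (fun h => hv (hs B hB h)) fun h => hv (hs C hC h)

theorem mem_trace_filter (V : Finset ℕ) (ω : ℕ → Bool) :
    ω ∈ trace V (V.filter fun v => ω v = true) := by
  intro v hv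
  by_cases h : ω v = true <;> simp [hv, h]

/-- The law of total probability, conditioning on the trace of the random set on `[0, t)`. -/
theorem density_eq_sum (p : I) (t : ℕ) (E : Set (Finset ℕ)) :
    density p E = ∑ B ∈ (Finset.range t).powerset,
      (p : ℝ) ^ B.card * (1 - p) ^ (t - B.card) * density p (contract t E B) := by
  have h₁ : avoid E = ⋃ B ∈ (Finset.range t).powerset, trace (Finset.range t) B ∩ avoid E := by
    ext ω
    simp only [Set.mem_iUnion, Finset.mem_powerset]
    exact ⟨fun h => ⟨_, Finset.filter_subset _ _, mem_trace_filter _ ω, h⟩,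
      fun ⟨_, _, h⟩ => h.2⟩
  rw [density, h₁, measureReal_biUnion_finset]
  · refine Finset.sum_congr rfl fun B hB => ?_
    rw [Finset.mem_powerset] at hB
    rw [trace_inter_avoid t E hB, law_real_inter p (S := (Finset.range t : Set ℕ))
      (T := Set.Ici t) _ (measurableSet_coordSigma_trace _ _)
      (measurableSet_coordSigma_avoid _), law_real_trace p hB, ← density, density_image_map,
      Finset.card_range]
    · refine Set.disjoint_left.2 fun v h₁ h₂ => ?_
      simp only [Finset.coe_range, Set.mem_Iio, Set.mem_Ici] at h₁ h₂
      omega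
    · rintro _ ⟨F, -, rfl⟩ v hv
      simp only [Finset.coe_map, Set.mem_image] at hv
      obtain ⟨u, -, rfl⟩ := hv
      simp
  · refine (pairwiseDisjoint_trace (Finset.range t) _ fun B hB => ?_).mono fun B =>
      Set.inter_subset_left
    exact Finset.mem_powerset.1 (Finset.mem_coe.1 hB)
  · exact fun B _ => (measurableSet_trace _ _).inter (measurableSet_avoid _)

theorem idp_eq_density (p : I) (C : FinHG) (h : ∀ e ∈ C.edges, e ⊆ C.verts) :
    C.idp p = density p C.edges := by
  have h₁ : avoid C.edges = ⋃ B ∈ C.verts.powerset.filter fun J => ∀ e ∈ C.edges, ¬ e ⊆ J,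
      trace C.verts B := by
    ext ω
    simp only [Set.mem_iUnion, Finset.mem_filter, Finset.mem_powerset]
    constructor
    · refine fun hω => ⟨_, ⟨Finset.filter_subset _ _, fun e he hs => ?_⟩, mem_trace_filter _ ω⟩
      obtain ⟨v, hv, hv'⟩ := hω e he
      simpa [hv'] using hs hv
    · rintro ⟨B, ⟨-, hB⟩, hω⟩ e he
      obtain ⟨v, hv, hvB⟩ := Finset.not_subset.1 (hB e he)
      exact ⟨v, hv, by simpa [hvB] using hω v (h e he hv)⟩
  rw [density, h₁, measureReal_biUnion_finset]
  · refine Finset.sum_congr rfl fun B hB => ?_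
    rw [law_real_trace p (Finset.mem_powerset.1 (Finset.mem_filter.1 hB).1)]
  · refine pairwiseDisjoint_trace _ _ fun B hB => ?_
    exact Finset.mem_powerset.1 (Finset.mem_filter.1 (Finset.mem_coe.1 hB)).1
  · exact fun B _ => measurableSet_trace _ _

theorem tendsto_density_iUnion (p : I) {E : ℕ → Set (Finset ℕ)} (h : Monotone E) :
    Tendsto (fun n => density p (E n)) atTop (𝓝 (density p (⋃ n, E n))) := by
  have h₁ : avoid (⋃ n, E n) = ⋂ n, avoid (E n) := by
    ext ω
    simp only [avoid, Set.mem_iUnion, Set.mem_ofPred_eq, Set.mem_iInter]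
    exact ⟨fun h n e he => h e ⟨n, he⟩, fun h e ⟨n, he⟩ => h n e he⟩
  rw [density, h₁]
  refine (ENNReal.tendsto_toReal (by finiteness)).comp
    (tendsto_measure_iInter_atTop (fun n => (measurableSet_avoid _).nullMeasurableSet)
      (fun m n hmn ω hω e he => hω e (h hmn he)) ⟨0, by finiteness⟩)

theorem isChain_tendsto (p : I) {H : HG} {C : ℕ → FinHG} (hC : H.IsChain C) :
    Tendsto (fun n => (C n).idp p) atTop (𝓝 (density p H.edges)) := by
  obtain ⟨h₁, -, h₃, -, h₅⟩ := hC
  have hm : Monotone fun n => ((C n).edges : Set (Finset ℕ)) := by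
    refine monotone_nat_of_le_succ fun n => ?_
    rw [h₃ n]
    exact Finset.coe_subset.2 (Finset.filter_subset _ _)
  simpa only [idp_eq_density p _ (h₁ _), h₅] using tendsto_density_iUnion p hm

open Classical in
theorem exists_isChain {H : HG} (hH : H.Valid) : ∃ C, H.IsChain C := by
  refine ⟨fun n => ⟨(Finset.range n).filter (· ∈ H.verts),
    ((Finset.range n).filter (· ∈ H.verts)).powerset.filter (· ∈ H.edges)⟩, ?_, ?_, ?_, ?_, ?_⟩
  · intro n e he
    simp only [Finset.mem_filter, Finset.mem_powerset] at he
    exact he.1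
  · intro n
    exact Finset.filter_subset_filter _ (Finset.range_mono n.le_succ)
  · intro n
    have : (Finset.range n).filter (· ∈ H.verts) ⊆ (Finset.range (n + 1)).filter (· ∈ H.verts) :=
      Finset.filter_subset_filter _ (Finset.range_mono n.le_succ)
    ext e
    simp only [Finset.mem_filter, Finset.mem_powerset]
    exact ⟨fun h => ⟨⟨h.1.trans this, h.2⟩, h.1⟩, fun h => ⟨h.2, h.1.2⟩⟩
  · ext v
    simp only [Set.mem_iUnion, Finset.mem_coe, Finset.mem_filter, Finset.mem_range]
    exact ⟨fun ⟨_, h⟩ => h.2, fun h => ⟨v + 1, v.lt_succ_self, h⟩⟩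
  · ext e
    simp only [Set.mem_iUnion, Finset.mem_coe, Finset.mem_filter, Finset.mem_powerset]
    refine ⟨fun ⟨_, h⟩ => h.2, fun h => ⟨e.sup id + 1, fun v hv => ?_, h⟩⟩
    exact Finset.mem_filter.2 ⟨Finset.mem_range.2 (Nat.lt_succ_of_le (Finset.le_sup (f := id) hv)),
      (hH e h).2 hv⟩

theorem idpLim_iff (p : I) {H : HG} (hH : H.Valid) (x : ℝ) :
    H.idpLim p x ↔ x = density p H.edges := by
  constructor
  · intro h
    obtain ⟨C, hC⟩ := exists_isChain hH
    exact tendsto_nhds_unique (h C hC) (isChain_tendsto p hC)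
  · rintro rfl C hC
    exact isChain_tendsto p hC

theorem density_insert (p : I) {e : Finset ℕ} {Q : Set (Finset ℕ)} {T : Set ℕ}
    (hQ : ∀ f ∈ Q, (f : Set ℕ) ⊆ T) (he : Disjoint (e : Set ℕ) T) :
    density p (insert e Q) = (1 - (p : ℝ) ^ e.card) * density p Q := by
  have : avoid (insert e Q) = avoid {e} ∩ avoid Q := by
    ext ω; simp [avoid]
  rw [density, this, law_real_inter p he (measurableSet_coordSigma_avoid (by simp))
    (measurableSet_coordSigma_avoid hQ), ← density, ← density, density_singleton]

/-- A greedy construction of either a small vertex cover or a large matching. -/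
theorem exists_cover_or_density_le (p : I) {D : ℕ} {E : Set (Finset ℕ)}
    (hE : ∀ e ∈ E, e.card ≤ D) (m : ℕ) :
    (∃ T : Finset ℕ, T.card ≤ D * m ∧ ∀ e ∈ E, ¬ Disjoint e T) ∨
      ∃ Q ⊆ E, ∃ T : Finset ℕ, T.card ≤ D * m ∧ (∀ f ∈ Q, f ⊆ T) ∧
        density p Q ≤ (1 - (p : ℝ) ^ D) ^ m := by
  induction m with
  | zero => exact Or.inr ⟨∅, Set.empty_subset _, ∅, by simp, by simp, by simp [density_empty]⟩
  | succ m ih =>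
    rcases ih with ⟨T, hT, h⟩ | ⟨Q, hQ, T, hT, hQT, h⟩
    · exact Or.inl ⟨T, hT.trans (Nat.mul_le_mul_left _ m.le_succ), h⟩
    by_cases hc : ∀ e ∈ E, ¬ Disjoint e T
    · exact Or.inl ⟨T, hT.trans (Nat.mul_le_mul_left _ m.le_succ), hc⟩
    push Not at hc
    obtain ⟨e, he, hd⟩ := hc
    refine Or.inr ⟨insert e Q, Set.insert_subset he hQ, e ∪ T, ?_, ?_, ?_⟩
    · have := Finset.card_union_le e T
      have := hE e he
      rw [Nat.mul_succ]
      omega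
    · rintro f (rfl | hf)
      · exact Finset.subset_union_left
      · exact (hQT f hf).trans Finset.subset_union_right
    · rw [density_insert p (T := T) (fun f hf => Finset.coe_subset.2 (hQT f hf))
        (Finset.disjoint_coe.2 hd), pow_succ']
      have h₁ : (p : ℝ) ^ D ≤ (p : ℝ) ^ e.card := pow_le_pow_of_le_one p.2.1 p.2.2 (hE e he)
      have h₂ : (p : ℝ) ^ D ≤ 1 := pow_le_one₀ p.2.1 p.2.2
      exact mul_le_mul (by linarith) h (density_nonneg p Q) (by linarith)

theorem exists_cover (p : I) (hp : 0 < p) (D : ℕ) {ε : ℝ} (hε : 0 < ε) :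
    ∃ M : ℕ, ∀ E : Set (Finset ℕ), (∀ e ∈ E, e.card ≤ D) → ε ≤ density p E →
      ∃ T : Finset ℕ, T.card ≤ M ∧ ∀ e ∈ E, ¬ Disjoint e T := by
  have hp' : 0 < (p : ℝ) ^ D := pow_pos hp D
  have h₂ : (p : ℝ) ^ D ≤ 1 := pow_le_one₀ p.2.1 p.2.2
  obtain ⟨m, hm⟩ := exists_pow_lt_of_lt_one hε (show 1 - (p : ℝ) ^ D < 1 by linarith)
  refine ⟨D * m, fun E hE hd => (exists_cover_or_density_le p hE m).resolve_right ?_⟩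
  rintro ⟨Q, hQ, -, -, -, h⟩
  linarith [density_anti p hQ]

theorem density_range_singleton (p : I) (hp : 0 < p) :
    density p (Set.range fun v : ℕ => ({v} : Finset ℕ)) = 0 := by
  by_contra h
  obtain ⟨M, hM⟩ := exists_cover p hp 1 (lt_of_le_of_ne (density_nonneg p _) (Ne.symm h))
  obtain ⟨T, -, hT⟩ := hM _ (by simp) le_rfl
  obtain ⟨v, hv⟩ := T.exists_notMem
  exact hT {v} ⟨v, rfl⟩ (by simpa using hv)

theorem exists_embedding_map_subset_range (T : Finset ℕ) :
    ∃ f : ℕ ↪ ℕ, ∀ v ∈ T, f v < T.card := by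
  classical
  let f (v : ℕ) : ℕ := if h : v ∈ T then T.equivFin ⟨v, h⟩ else T.card + v
  suffices hf : f.Injective from ⟨⟨f, hf⟩, fun v hv => by simp [f, hv]⟩
  intro u v h
  by_cases hu : u ∈ T <;> by_cases hv : v ∈ T <;> simp only [f, hu, hv, dite_true, dite_false] at h
  · simpa using T.equivFin.injective (Fin.ext h)
  · have := (T.equivFin ⟨u, hu⟩).2
    omega
  · have := (T.equivFin ⟨v, hv⟩).2
    omega
  · omega

/-- Every hypergraph of positive density can be relabelled so that it has a vertex cover which is
a short initial segment. -/
theorem exists_relabel (p : I) (hp : 0 < p) (D : ℕ) {ε : ℝ} (hε : 0 < ε) (n : ℕ) :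
    ∃ t : ℕ, ∀ (ι : Type) [Fintype ι] (E : ι → Set (Finset ℕ)), Fintype.card ι = n →
      (∀ i, ∀ e ∈ E i, e.card ≤ D) → (∀ i, ε ≤ density p (E i)) →
      ∃ f : ℕ ↪ ℕ, ∀ i, ∀ e ∈ E i, ∃ v ∈ e, f v < t := by
  obtain ⟨M, hM⟩ := exists_cover p hp D hε
  refine ⟨n * M, fun ι _ E hn hE hd => ?_⟩
  choose T hT hc using fun i => hM (E i) (hE i) (hd i)
  obtain ⟨f, hf⟩ := exists_embedding_map_subset_range (Finset.univ.biUnion T)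
  refine ⟨f, fun i e he => ?_⟩
  obtain ⟨v, hv, hvT⟩ := Finset.not_disjoint_iff.1 (hc i e he)
  refine ⟨v, hv, (hf v (Finset.mem_biUnion.2 ⟨i, Finset.mem_univ i, hvT⟩)).trans_le ?_⟩
  rw [← hn, ← Finset.card_univ]
  exact Finset.card_biUnion_le_card_mul _ _ _ fun i _ => hT i

theorem disjoint_map_addRight {t : ℕ} {C : Finset ℕ} (hC : C ⊆ Finset.range t) (F : Finset ℕ) :
    Disjoint C (F.map (addRightEmbedding t)) := by
  refine Finset.disjoint_left.2 fun v hv hv' => ?_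
  have := Finset.mem_range.1 (hC hv)
  obtain ⟨u, -, hu⟩ := Finset.mem_map.1 hv'
  simp only [addRightEmbedding_apply] at hu
  omega

theorem union_map_addRight_injective {t : ℕ} {C C' F F' : Finset ℕ} (hC : C ⊆ Finset.range t)
    (hC' : C' ⊆ Finset.range t)
    (h : C ∪ F.map (addRightEmbedding t) = C' ∪ F'.map (addRightEmbedding t)) :
    C = C' ∧ F = F' := by
  have key (A G : Finset ℕ) (hA : A ⊆ Finset.range t) :
      (A ∪ G.map (addRightEmbedding t)) ∩ Finset.range t = A := by
    have : Disjoint (G.map (addRightEmbedding t)) (Finset.range t) :=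
      (disjoint_map_addRight subset_rfl G).symm
    rw [Finset.union_inter_distrib_right, Finset.inter_eq_left.2 hA,
      Finset.disjoint_iff_inter_eq_empty.1 this, Finset.union_empty]
  have hCC : C = C' := by rw [← key C F hC, h, key C' F' hC']
  refine ⟨hCC, Finset.map_injective (addRightEmbedding t) ?_⟩
  subst hCC
  rw [← Finset.union_sdiff_cancel_left (disjoint_map_addRight hC F), h,
    Finset.union_sdiff_cancel_left (disjoint_map_addRight hC F')]

open Classical in
theorem contract_iUnion {ι : Type} (t : ℕ) (S : Finset ι) (A : ι → Set (Finset ℕ))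
    (L : ι × (Finset.range t).powerset → Set (Finset ℕ))
    (h : ∀ i ∈ S, ∀ C F, F ∈ L (i, C) ↔ C.1 ∪ F.map (addRightEmbedding t) ∈ A i)
    {B : Finset ℕ} (hB : B ⊆ Finset.range t) :
    contract t (⋃ i ∈ S, A i) B =
      ⋃ x ∈ S ×ˢ Finset.univ.filter (fun C : (Finset.range t).powerset => C.1 ⊆ B), L x := by
  ext F
  simp only [contract, Set.mem_iUnion, Set.mem_ofPred_eq, Finset.mem_product, Finset.mem_filter,
    Finset.mem_univ, true_and, Prod.exists, exists_prop]
  constructor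
  · rintro ⟨C, hC, i, hi, hF⟩
    exact ⟨i, ⟨C, Finset.mem_powerset.2 (hC.trans hB)⟩, ⟨hi, hC⟩, (h i hi _ F).2 hF⟩
  · rintro ⟨i, C, ⟨hi, hC⟩, hF⟩
    exact ⟨C.1, hC, i, hi, (h i hi C F).1 hF⟩

/-- A compactness property of finite families of hypergraphs with prescribed bounds on the sizes of
edges, on a common vertex set. -/
theorem exists_subseq_tendsto (p : I) (hp : 0 < p) (D : ℕ) :
    ∀ (ι : Type) [Fintype ι] (d : ι → ℕ) (E : ℕ → ι → Set (Finset ℕ)), (∀ i, d i ≤ D) →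
      (∀ j i, ∀ e ∈ E j i, e.card < d i) →
      ∃ (φ : ℕ → ℕ) (L : ι → Set (Finset ℕ)), StrictMono φ ∧ (∀ i, ∀ e ∈ L i, e.card < d i) ∧
        ∀ S : Finset ι, Tendsto (fun j => density p (⋃ i ∈ S, E (φ j) i)) atTop
          (𝓝 (density p (⋃ i ∈ S, L i))) := by
  classical
  induction D with
  | zero =>
    intro ι _ d E hd hE
    refine ⟨id, fun _ => ∅, strictMono_id, by simp, fun S => ?_⟩
    have h (j i) : E j i = ∅ := Set.eq_empty_of_forall_notMem fun e he => by
      have := hE j i e he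
      have := hd i
      omega
    simp [h]
  | succ D ih =>
    intro ι _ d E hd hE
    obtain ⟨a, -, φ, hφ, ha⟩ := (isCompact_univ_pi fun _ : ι => isCompact_Icc).tendsto_subseq
      (x := fun j i => density p (E j i))
      fun j i _ => (⟨density_nonneg p _, density_le_one p _⟩ : _ ∈ Set.Icc (0 : ℝ) 1)
    rw [tendsto_pi_nhds] at ha
    have ha0 (i) : 0 ≤ a i := ge_of_tendsto' (ha i) fun j => density_nonneg p _
    obtain ⟨ε, hε, hε1, hεa⟩ : ∃ ε : ℝ, 0 < ε ∧ ε ≤ 1 ∧ ∀ i, a i ≠ 0 → ε < a i := by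
      have h : ∀ᶠ ε in 𝓝[>] (0 : ℝ), ∀ i, a i ≠ 0 → ε < a i := by
        refine eventually_all.2 fun i => ?_
        by_cases hi : a i = 0
        · simp [hi]
        · have : Set.Iio (a i) ∈ 𝓝[>] (0 : ℝ) :=
            nhdsWithin_le_nhds (Iio_mem_nhds (lt_of_le_of_ne (ha0 i) (Ne.symm hi)))
          filter_upwards [this] with ε h _ using h
      obtain ⟨ε, h, h1, h0⟩ := (h.and ((Ioc_mem_nhdsGT one_pos :
        Set.Ioc (0 : ℝ) 1 ∈ _))).exists
      exact ⟨ε, h1, h0, h⟩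
    obtain ⟨N, hN⟩ : ∃ N, ∀ j ≥ N, ∀ i, a i ≠ 0 → ε ≤ density p (E (φ j) i) := by
      refine eventually_atTop.1 (eventually_all.2 fun i => ?_)
      by_cases hi : a i = 0
      · simp [hi]
      · filter_upwards [(ha i).eventually (lt_mem_nhds (hεa i hi))] with j hj _ using hj.le
    obtain ⟨t, ht⟩ := exists_relabel p hp D hε (Fintype.card ι)
    have hf (j : ℕ) := ht ι (fun i => if a i = 0 then ∅ else E (φ (N + j)) i) rfl
      (fun i e he => by
        split_ifs at he with hi
        · exact he.elim
        · have := hE _ i e he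
          have := hd i
          omega)
      (fun i => by
        by_cases hi : a i = 0
        · simpa [hi, density_empty] using hε1
        · simpa [hi] using hN (N + j) (Nat.le_add_right N j) i hi)
    choose f hf using hf
    have hcov (j i) (hi : a i ≠ 0) (e : Finset ℕ) (he : e ∈ E (φ (N + j)) i) :
        ∃ v ∈ e, f j v < t := hf j i e (by simpa [hi] using he)
    obtain ⟨ψ, L, hψ, hL, hlim⟩ := ih (ι × (Finset.range t).powerset)
      (fun x => if x.2.1 = ∅ ∨ a x.1 = 0 then 0 else d x.1 - x.2.1.card)
      (fun j x => if a x.1 = 0 then ∅ else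
        {F | x.2.1 ∪ F.map (addRightEmbedding t) ∈ Finset.map (f j) '' E (φ (N + j)) x.1})
      (fun x => by
        have := hd x.1
        split_ifs with h
        · omega
        · have := Finset.card_pos.2 (Finset.nonempty_iff_ne_empty.2 (not_or.1 h).1)
          omega)
      (fun j x F hF => by
        split_ifs at hF with hi
        · exact hF.elim
        obtain ⟨e, he, heq⟩ := hF
        have hx : x.2.1 ≠ ∅ := by
          intro hx
          obtain ⟨v, hv, hvt⟩ := hcov j x.1 hi e he
          have := Finset.mem_map_of_mem (f j) hv
          rw [heq, hx, Finset.empty_union, Finset.mem_map] at this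
          obtain ⟨u, -, hu⟩ := this
          simp only [addRightEmbedding_apply] at hu
          omega
        rw [if_neg (by tauto)]
        have hdisj := disjoint_map_addRight (Finset.mem_powerset.1 x.2.2) F
        have h₁ := congrArg Finset.card heq
        rw [Finset.card_map, Finset.card_union_of_disjoint hdisj, Finset.card_map] at h₁
        have := hE _ _ e he
        omega)
    have hφ' : StrictMono fun j => φ (N + ψ j) :=
      hφ.comp ((strictMono_id.const_add N).comp hψ)
    have hψN : Tendsto (fun j => N + ψ j) atTop atTop :=
      ((strictMono_id.const_add N).comp hψ).tendsto_atTop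
    let G (i : ι) : Set (Finset ℕ) := if a i = 0 then {∅} else
      {e | ∃ C, ∃ F ∈ L (i, C), e = C.1 ∪ F.map (addRightEmbedding t)}
    refine ⟨fun j => φ (N + ψ j), G, hφ', fun i e he => ?_, fun S => ?_⟩
    · by_cases hi : a i = 0
      · simp only [G, hi, if_true, Set.mem_singleton_iff] at he
        rw [he, Finset.card_empty]
        by_contra hd0
        have h₁ (j) : density p (E (φ j) i) = 1 := by
          have h₂ : E (φ j) i = ∅ :=
            Set.eq_empty_of_forall_notMem fun e he => hd0 (Nat.zero_lt_of_lt (hE _ i e he))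
          rw [h₂, density_empty]
        have h₃ := ha i
        simp only [Function.comp_apply, h₁, hi] at h₃
        exact one_ne_zero (tendsto_nhds_unique tendsto_const_nhds h₃)
      · simp only [G, hi, if_false] at he
        obtain ⟨C, F, hF, rfl⟩ := he
        have h₁ : F.card < if C.1 = ∅ ∨ a i = 0 then 0 else d i - C.1.card := hL _ F hF
        have h₂ := Finset.card_union_le C.1 (F.map (addRightEmbedding t))
        rw [Finset.card_map] at h₂
        split_ifs at h₁
        all_goals omega
    by_cases hS : ∃ i ∈ S, a i = 0
    · obtain ⟨i, hiS, hi⟩ := hS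
      have hG : density p (⋃ i ∈ S, G i) = 0 :=
        density_eq_zero p (Set.mem_biUnion hiS (by simp [G, hi]))
      rw [hG]
      refine squeeze_zero (fun j => density_nonneg p _) (fun j => density_anti p
        (Set.subset_biUnion_of_mem (u := fun i => E (φ (N + ψ j)) i) hiS)) ?_
      simpa [hi, Function.comp_def] using (ha i).comp hψN
    · push Not at hS
      have h₁ (j) : density p (⋃ i ∈ S, E (φ (N + ψ j)) i) =
          density p (⋃ i ∈ S, Finset.map (f (ψ j)) '' E (φ (N + ψ j)) i) := by
        rw [← density_image_map p (f (ψ j)), Set.image_iUnion₂]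
      simp only [h₁]
      rw [density_eq_sum p t, funext fun j => density_eq_sum p t _]
      refine tendsto_finsetSum _ fun B hB => Tendsto.const_mul _ ?_
      rw [Finset.mem_powerset] at hB
      rw [contract_iUnion t S G L _ hB]
      · convert! hlim _ using 3 with j
        refine contract_iUnion t S _ _ (fun i hi C F => ?_) hB
        simp [hS i hi]
      · intro i hi C F
        simp only [G, hS i hi, if_false, Set.mem_ofPred_eq]
        refine ⟨fun h => ⟨C, F, h, rfl⟩, fun ⟨C', F', h, heq⟩ => ?_⟩
        obtain ⟨hC, rfl⟩ := union_map_addRight_injective (Finset.mem_powerset.1 C.2)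
          (Finset.mem_powerset.1 C'.2) heq
        rwa [Subtype.ext hC]

theorem mem_HkSet_iff (p : I) {k : ℕ} {x : ℝ} :
    x ∈ HkSet k p ↔ ∃ E : Set (Finset ℕ), (∀ e ∈ E, e.Nonempty ∧ e.card ≤ k) ∧
      x = density p E := by
  constructor
  · rintro ⟨H, hH, hr, hx⟩
    exact ⟨H.edges, fun e he => ⟨(hH e he).1, hr e he⟩, (idpLim_iff p hH x).1 hx⟩
  · rintro ⟨E, hE, hx⟩
    have hH : (HG.mk Set.univ E).Valid := fun e he => ⟨(hE e he).1, Set.subset_univ _⟩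
    exact ⟨⟨Set.univ, E⟩, hH, fun e he => (hE e he).2, (idpLim_iff p hH x).2 hx⟩

theorem isClosed_HkSet (p : I) (hp : 0 < p) {k : ℕ} (hk : 1 ≤ k) : IsClosed (HkSet k p) := by
  refine IsSeqClosed.isClosed fun x y hx hy => ?_
  choose E hE hxE using fun n => (mem_HkSet_iff p).1 (hx n)
  obtain ⟨φ, L, hφ, hL, hlim⟩ := exists_subseq_tendsto p hp (k + 1) Unit (fun _ => k + 1)
    (fun j _ => E j) (fun _ => le_rfl) (fun j _ e he => Nat.lt_succ_of_le (hE j e he).2)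
  have hyL : y = density p (L ()) := by
    refine tendsto_nhds_unique (hy.comp hφ.tendsto_atTop) ?_
    simpa only [Function.comp_def, hxE, Finset.set_biUnion_singleton] using hlim {()}
  rw [mem_HkSet_iff]
  by_cases h : ∅ ∈ L ()
  · refine ⟨Set.range fun v => {v}, ?_, ?_⟩
    · rintro _ ⟨v, rfl⟩
      simpa using hk
    · rw [hyL, density_eq_zero p h, density_range_singleton p hp]
  · exact ⟨L (), fun e he => ⟨Finset.nonempty_iff_ne_empty.2 fun h' => h (h' ▸ he),
      Nat.le_of_lt_succ (hL () e he)⟩, hyL⟩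

end RandomSubset

/-- For every `k ≥ 1` and `p ∈ (0,1)`, the set `H_{k,p}` of independence
`p`-densities of countable hypergraphs of rank at most `k` is closed in `ℝ`. -/
theorem stmt_2 (k : ℕ) (hk : 1 ≤ k) (p : ℝ) (hp0 : 0 < p) (hp1 : p < 1) :
    IsClosed (HkSet k p) := by
  exact RandomSubset.isClosed_HkSet ⟨p, hp0.le, hp1.le⟩ hp0 hk
end

section
/- Let k ≥ 2, p ∈ (0,1), and let {x_n : n ≥ 1} ⊆ H_{k,p} satisfy inf_{n≥1} x_n = x > 0. Then there exists a sequence {H_n}_{n≥1} of countable hypergraphs on vertex set ℕ such that for every n, r(H_n) ≤ k and id_p(H_n) = x_n, together with a finite hypergraph H_0 on a finite vertex set V_0 ⊆ ℕ and a strictly increasing sequence {n_i}_{i≥1} of indices such that for every i ≥ 1: (a) the induced subhypergraph H_{n_i}[V_0] equals H_0, and (b) for every hyperedge E ∈ H_{n_i} with E \ V_0 ≠ ∅, there exists A ⊆ E ∩ V_0 such that the hypergraph {F ⊆ ℕ \ V_0 : F ∪ A ∈ H_{n_i}} contains a matching of size at least i. -/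
open Filter Topology

namespace FinHG

theorem idp_eq_sum_ite (V : Finset ℕ) (S : Finset (Finset ℕ)) (p : ℝ) :
    idp ⟨V, S⟩ p = ∑ I ∈ V.powerset,
      if ∀ e ∈ S, ¬ e ⊆ I then p ^ I.card * (1 - p) ^ (V.card - I.card) else 0 := by
  unfold idp
  rw [Finset.sum_filter]

theorem idp_insert {v : ℕ} {V : Finset ℕ} {S : Finset (Finset ℕ)} (p : ℝ) (hv : v ∉ V)
    (hS : ∀ e ∈ S, v ∉ e) : idp ⟨insert v V, S⟩ p = idp ⟨V, S⟩ p := by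
  rw [idp_eq_sum_ite, idp_eq_sum_ite, Finset.sum_powerset_insert hv, ← Finset.sum_add_distrib]
  refine Finset.sum_congr rfl fun I hI => ?_
  have hIV := Finset.mem_powerset.1 hI
  have hvI : v ∉ I := fun h => hv (hIV h)
  have hiff : (∀ e ∈ S, ¬ e ⊆ insert v I) ↔ ∀ e ∈ S, ¬ e ⊆ I := by
    refine forall₂_congr fun e he => ?_
    rw [Finset.subset_insert_iff_of_notMem (hS e he)]
  simp only [hiff]
  split_ifs
  · rw [Finset.card_insert_of_notMem hv, Finset.card_insert_of_notMem hvI,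
      Nat.add_sub_add_right, Nat.succ_sub (Finset.card_le_card hIV), pow_succ, pow_succ]
    ring
  · simp

theorem idp_eq_of_subset {V W : Finset ℕ} {S : Finset (Finset ℕ)} (p : ℝ) (hVW : V ⊆ W)
    (hS : ∀ e ∈ S, e ⊆ V) : idp ⟨W, S⟩ p = idp ⟨V, S⟩ p := by
  have key : ∀ D : Finset ℕ, Disjoint D V → idp ⟨D ∪ V, S⟩ p = idp ⟨V, S⟩ p := by
    intro D
    induction D using Finset.induction_on with
    | empty => intro; simp
    | insert v D hvD ih =>
      intro hdisj
      rw [Finset.disjoint_insert_left] at hdisj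
      rw [Finset.insert_union, idp_insert p, ih hdisj.2]
      · simp [hvD, hdisj.1]
      · exact fun e he hve => hdisj.1 (hS e he hve)
  rw [← key (W \ V) Finset.sdiff_disjoint, Finset.sdiff_union_of_subset hVW]

theorem idp_map (V : Finset ℕ) (S : Finset (Finset ℕ)) (p : ℝ) (σ : Equiv.Perm ℕ) :
    idp ⟨V.map σ.toEmbedding, S.image fun e => e.map σ.toEmbedding⟩ p = idp ⟨V, S⟩ p := by
  rw [idp_eq_sum_ite, idp_eq_sum_ite]
  symm
  refine Finset.sum_equiv σ.finsetCongr ?_ ?_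
  · intro I
    simp [Equiv.finsetCongr]
  · intro I _
    simp [Equiv.finsetCongr]

end FinHG

namespace HG

/-- The image of a hypergraph under a permutation of `ℕ`, with vertex set enlarged to `ℕ`. -/
def permute (σ : Equiv.Perm ℕ) (H : HG) : HG :=
  ⟨Set.univ, (fun e => e.map σ.toEmbedding) '' H.edges⟩

theorem map_symm_map (σ : Equiv.Perm ℕ) (e : Finset ℕ) :
    (e.map σ.toEmbedding).map σ.symm.toEmbedding = e := by
  simp [Finset.map_map]

open Classical in
theorem idpLim_permute {H : HG} {p x : ℝ} (hV : H.Valid) (hx : H.idpLim p x)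
    (σ : Equiv.Perm ℕ) : (H.permute σ).idpLim p x := by
  intro C hC
  obtain ⟨h1, h2, h3, h4, h5⟩ := hC
  let D : ℕ → FinHG := fun n =>
    ⟨((C n).verts.map σ.symm.toEmbedding).filter (· ∈ H.verts),
      (C n).edges.image fun e => e.map σ.symm.toEmbedding⟩
  have hmem : ∀ n, ∀ e ∈ (C n).edges, e.map σ.symm.toEmbedding ∈ H.edges := by
    intro n e he
    have : e ∈ (H.permute σ).edges := by
      rw [← h5]
      exact Set.mem_iUnion.2 ⟨n, he⟩
    obtain ⟨e', he', rfl⟩ := this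
    rwa [map_symm_map]
  have hsub : ∀ n, ∀ e ∈ (D n).edges, e ⊆ (D n).verts := by
    intro n e he
    obtain ⟨e', he', rfl⟩ := Finset.mem_image.1 he
    intro v hv
    refine Finset.mem_filter.2 ⟨?_, (hV _ (hmem n e' he')).2 hv⟩
    exact Finset.map_subset_map.2 (h1 n e' he') hv
  have hD : H.IsChain D := by
    refine ⟨hsub, ?_, ?_, ?_, ?_⟩
    · intro n
      exact Finset.filter_subset_filter _ (Finset.map_subset_map.2 (h2 n))
    · intro n
      ext e
      constructor
      · intro he
        refine Finset.mem_filter.2 ⟨?_, hsub n e he⟩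
        obtain ⟨e', he', rfl⟩ := Finset.mem_image.1 he
        rw [h3 n] at he'
        exact Finset.mem_image_of_mem _ (Finset.mem_filter.1 he').1
      · intro he
        obtain ⟨he, hs⟩ := Finset.mem_filter.1 he
        obtain ⟨e', he', rfl⟩ := Finset.mem_image.1 he
        refine Finset.mem_image_of_mem _ ?_
        rw [h3 n]
        refine Finset.mem_filter.2 ⟨he', ?_⟩
        exact Finset.map_subset_map.1 (hs.trans (Finset.filter_subset _ _))
    · ext v
      have hv : σ v ∈ ⋃ n, ((C n).verts : Set ℕ) := by
        rw [h4]
        exact Set.mem_univ _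
      obtain ⟨n, hn⟩ := Set.mem_iUnion.1 hv
      simp only [Set.mem_iUnion]
      constructor
      · rintro ⟨m, hm⟩
        exact (Finset.mem_filter.1 hm).2
      · intro h
        exact ⟨n, Finset.mem_filter.2 ⟨Finset.mem_map.2 ⟨σ v, hn, by simp⟩, h⟩⟩
    · ext e
      simp only [Set.mem_iUnion]
      constructor
      · rintro ⟨n, hn⟩
        obtain ⟨e', he', rfl⟩ := Finset.mem_image.1 hn
        exact hmem n e' he'
      · intro he
        have : e.map σ.toEmbedding ∈ ⋃ n, ((C n).edges : Set (Finset ℕ)) := by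
          rw [h5]
          exact ⟨e, he, rfl⟩
        obtain ⟨n, hn⟩ := Set.mem_iUnion.1 this
        exact ⟨n, Finset.mem_image.2 ⟨_, hn, map_symm_map σ e⟩⟩
  refine (hx D hD).congr fun n => ?_
  rw [← FinHG.idp_map (C n).verts (C n).edges p σ.symm]
  exact (FinHG.idp_eq_of_subset p (Finset.filter_subset _ _) (hsub n)).symm

theorem valid_permute {H : HG} (hV : H.Valid) (σ : Equiv.Perm ℕ) : (H.permute σ).Valid := by
  rintro _ ⟨e, he, rfl⟩
  exact ⟨(hV e he).1.map, Set.subset_univ _⟩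

theorem rankLe_permute {H : HG} {k : ℕ} (hk : H.RankLe k) (σ : Equiv.Perm ℕ) :
    (H.permute σ).RankLe k := by
  rintro _ ⟨e, he, rfl⟩
  simpa using hk e he

end HG

theorem HasMatching.exists_cover {S : Set (Finset ℕ)} {k m : ℕ} (hk : ∀ F ∈ S, F.card ≤ k)
    (h : ¬ HasMatching S m) :
    ∃ T : Finset ℕ, T.card ≤ m * k ∧ (∀ v ∈ T, ∃ F ∈ S, v ∈ F) ∧
      ∀ F ∈ S, F.Nonempty → ∃ v ∈ F, v ∈ T := by
  induction m with
  | zero => exact absurd ⟨∅, by simp, by simp, by simp, by simp⟩ h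
  | succ m ih =>
    by_cases hm : HasMatching S m
    · obtain ⟨M, hMS, hMne, hMd, hMc⟩ := hm
      have hcard : M.card ≤ m + 1 := by
        by_contra! hlt
        exact h ⟨M, hMS, hMne, hMd, hlt.le⟩
      refine ⟨M.biUnion id, ?_, ?_, ?_⟩
      · exact (Finset.card_biUnion_le_card_mul _ _ k fun F hF => hk F (hMS hF)).trans
          (Nat.mul_le_mul_right k hcard)
      · intro v hv
        obtain ⟨F, hF, hvF⟩ := Finset.mem_biUnion.1 hv
        exact ⟨F, hMS hF, hvF⟩
      · intro F hF hne
        by_contra! hdis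
        have hd : ∀ G ∈ M, Disjoint F G := fun G hG =>
          Finset.disjoint_left.2 fun v hv hvG => hdis v hv (Finset.mem_biUnion.2 ⟨G, hG, hvG⟩)
        have hFM : F ∉ M := fun hFM => hne.ne_empty (disjoint_self.1 (hd F hFM))
        refine h ⟨insert F M, ?_, ?_, ?_, ?_⟩
        · rw [Finset.coe_insert]
          exact Set.insert_subset hF hMS
        · simpa [hne] using hMne
        · rw [Finset.coe_insert]
          exact hMd.insert fun G hG _ => ⟨hd G hG, (hd G hG).symm⟩
        · rw [Finset.card_insert_of_notMem hFM]
          omega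
    · obtain ⟨T, hT, hT'⟩ := ih hm
      exact ⟨T, hT.trans (Nat.mul_le_mul_right k m.le_succ), hT'⟩

/-- Each vertex of `W` meets at most one member of a matching. -/
theorem HasMatching.avoid {S : Set (Finset ℕ)} {m : ℕ} (W : Finset ℕ)
    (h : HasMatching S (m + W.card)) : HasMatching {F ∈ S | Disjoint F W} m := by
  obtain ⟨M, hMS, hMne, hMd, hMc⟩ := h
  refine ⟨M.filter fun F => Disjoint F W, ?_, ?_, ?_, ?_⟩
  · intro F hF
    obtain ⟨hF, hd⟩ := Finset.mem_filter.1 (Finset.mem_coe.1 hF)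
    exact ⟨hMS hF, hd⟩
  · exact fun F hF => hMne F (Finset.mem_filter.1 hF).1
  · exact hMd.mono (Finset.coe_subset.2 (Finset.filter_subset _ _))
  · have hle : (M.filter fun F => ¬ Disjoint F W).card ≤ W.card := by
      have hex : ∀ F : Finset ℕ, ¬ Disjoint F W → ∃ v ∈ F, v ∈ W := fun F hF =>
        Finset.not_disjoint_iff.1 hF
      choose! f hf using hex
      refine Finset.card_le_card_of_injOn f (fun F hF => ?_) fun F hF G hG hFG => ?_
      · exact (hf F (Finset.mem_filter.1 hF).2).2
      · obtain ⟨hF, hF'⟩ := Finset.mem_filter.1 (Finset.mem_coe.1 hF)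
        obtain ⟨hG, hG'⟩ := Finset.mem_filter.1 (Finset.mem_coe.1 hG)
        by_contra hne
        exact Finset.disjoint_left.1 (hMd hF hG hne) (hf F hF').1 (hFG ▸ (hf G hG').1)
    have := Finset.card_filter_add_card_filter_not (s := M) (fun F => Disjoint F W)
    omega

theorem HasMatching.map {S S' : Set (Finset ℕ)} {m : ℕ} (σ : Equiv.Perm ℕ)
    (hSS' : ∀ F ∈ S, F.map σ.toEmbedding ∈ S') (h : HasMatching S m) : HasMatching S' m := by
  obtain ⟨M, hMS, hMne, hMd, hMc⟩ := h
  refine ⟨M.map ⟨fun F => F.map σ.toEmbedding, Finset.map_injective _⟩, ?_, ?_, ?_, by simpa⟩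
  · intro F hF
    simp only [Finset.coe_map, Set.mem_image] at hF
    obtain ⟨G, hG, rfl⟩ := hF
    exact hSS' G (hMS hG)
  · simpa using hMne
  · rw [Finset.coe_map]
    rintro _ ⟨F, hF, rfl⟩ _ ⟨G, hG, rfl⟩ hne
    exact (Finset.disjoint_map _).2 (hMd hF hG fun h => hne (h ▸ rfl))

/-- A finite set of integers at least `N` can be packed just above `N` by a permutation fixing
everything below `N`. -/
theorem exists_perm_pack (N : ℕ) (T : Finset ℕ) (hT : ∀ v ∈ T, N ≤ v) :
    ∃ τ : Equiv.Perm ℕ, (∀ v < N, τ v = v) ∧ ∀ v ∈ T, τ v < N + T.card := by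
  induction T using Finset.induction_on with
  | empty => exact ⟨1, by simp, by simp⟩
  | insert v T hv ih =>
    obtain ⟨τ, h1, h2⟩ := ih fun w hw => hT w (Finset.mem_insert_of_mem hw)
    rw [Finset.card_insert_of_notMem hv]
    by_cases hlt : τ v < N + T.card
    · refine ⟨τ, h1, fun w hw => ?_⟩
      rcases Finset.mem_insert.1 hw with rfl | hw
      · omega
      · have := h2 w hw
        omega
    · refine ⟨Equiv.swap (τ v) (N + T.card) * τ, fun w hw => ?_, fun w hw => ?_⟩
      · rw [Equiv.Perm.mul_apply, h1 w hw, Equiv.swap_apply_of_ne_of_ne] <;> omega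
      · rw [Equiv.Perm.mul_apply]
        rcases Finset.mem_insert.1 hw with rfl | hw
        · rw [Equiv.swap_apply_left]
          omega
        · have := h2 w hw
          rw [Equiv.swap_apply_of_ne_of_ne] <;> omega

/-- The sets `F` of integers at least `N` such that `F ∪ A` belongs to `S`. -/
def linkAbove (S : Set (Finset ℕ)) (N : ℕ) (A : Finset ℕ) : Set (Finset ℕ) :=
  {F | (F : Set ℕ) ⊆ ((Finset.range N : Finset ℕ) : Set ℕ)ᶜ ∧ F ∪ A ∈ S}

theorem map_eq_self_of_fixed {N : ℕ} {τ : Equiv.Perm ℕ} (hτ : ∀ v < N, τ v = v)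
    {A : Finset ℕ} (hA : A ⊆ Finset.range N) : A.map τ.toEmbedding = A := by
  refine Finset.eq_of_subset_of_card_le (fun v hv => ?_) (by simp)
  obtain ⟨w, hw, rfl⟩ := Finset.mem_map.1 hv
  have := hτ w (Finset.mem_range.1 (hA hw))
  simpa [this] using hw

theorem HasMatching.linkAbove_map {S : Set (Finset ℕ)} {N N' m : ℕ} {A : Finset ℕ}
    {τ : Equiv.Perm ℕ} (hτ : ∀ v < N, τ v = v) (hA : A ⊆ Finset.range N)
    (h : HasMatching (linkAbove S N A) (m + N')) :
    HasMatching (linkAbove ((fun e => e.map τ.toEmbedding) '' S) N' A) m := by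
  have h' : HasMatching {F | F ∪ A ∈ (fun e => e.map τ.toEmbedding) '' S}
      (m + (Finset.range N').card) := by
    rw [Finset.card_range]
    refine h.map τ fun F hF => ⟨F ∪ A, hF.2, ?_⟩
    simp only [Finset.map_union, map_eq_self_of_fixed hτ hA]
  obtain ⟨M, hM, hrest⟩ := h'.avoid
  refine ⟨M, fun F hF => ⟨fun v hv hvN => ?_, (hM hF).1⟩, hrest⟩
  exact Finset.disjoint_left.1 (hM hF).2 hv hvN

/-- Along an ultrafilter, a sequence of families of sets of size at most `k` can be permuted so that,
for one initial segment `range N`, each member leaving `range N` either contains a subset of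
`range N` whose links have unboundedly large matchings, or meets `range N` in `j` points. -/
theorem exists_permutation_core (k : ℕ) (U : Ultrafilter ℕ) (Es : ℕ → Set (Finset ℕ))
    (hk : ∀ n, ∀ e ∈ Es n, e.card ≤ k) (j : ℕ) :
    ∃ (N : ℕ) (σ : ℕ → Equiv.Perm ℕ) (Gs : ℕ → Set (Finset ℕ)),
      (∀ n, Gs n = (fun e => e.map (σ n).toEmbedding) '' Es n) ∧
      ∀ᶠ n in U, ∀ E ∈ Gs n, ¬ E ⊆ Finset.range N →
        (∃ A ⊆ E ∩ Finset.range N, ∀ m, ∀ᶠ n' in U, HasMatching (linkAbove (Gs n') N A) m) ∨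
        j ≤ (E ∩ Finset.range N).card := by
  classical
  induction j with
  | zero =>
    exact ⟨0, fun _ => 1, _, fun _ => rfl, Eventually.of_forall fun n E _ _ => Or.inr (by simp)⟩
  | succ j ih =>
    obtain ⟨N, σ, Gs, hGs, hev⟩ := ih
    have hkG : ∀ n, ∀ e ∈ Gs n, e.card ≤ k := by
      intro n e he
      rw [hGs] at he
      obtain ⟨e', he', rfl⟩ := he
      simpa using hk n e' he'
    let Large : Finset ℕ → Prop := fun A =>
      ∀ m, ∀ᶠ n in U, HasMatching (linkAbove (Gs n) N A) m
    have hsmall : ∀ A, ¬ Large A → ∃ m, ∀ᶠ n in U, ¬ HasMatching (linkAbove (Gs n) N A) m := by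
      intro A hA
      simp only [Large, not_forall, ← Ultrafilter.eventually_not] at hA
      exact hA
    choose! b hb using hsmall
    let Q : ℕ → Prop := fun n => ∀ A ∈ (Finset.range N).powerset, ¬ Large A →
      ¬ HasMatching (linkAbove (Gs n) N A) (b A)
    have hQ : ∀ᶠ n in U, Q n := by
      refine (Filter.eventually_all_finset _).2 fun A _ => ?_
      by_cases hA : Large A
      · exact Eventually.of_forall fun n h => absurd hA h
      · exact (hb A hA).mono fun n hn _ => hn
    let M : ℕ := ∑ A ∈ (Finset.range N).powerset, b A * k
    have hcover : ∀ n, ∃ T : Finset ℕ, T.card ≤ M ∧ (∀ v ∈ T, N ≤ v) ∧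
        (Q n → ∀ A ∈ (Finset.range N).powerset, ¬ Large A → ∀ F ∈ linkAbove (Gs n) N A,
          F.Nonempty → ∃ v ∈ F, v ∈ T) := by
      intro n
      by_cases hn : Q n
      · have hT : ∀ A ∈ (Finset.range N).powerset, ∃ T : Finset ℕ, T.card ≤ b A * k ∧
            (∀ v ∈ T, N ≤ v) ∧ (¬ Large A → ∀ F ∈ linkAbove (Gs n) N A,
              F.Nonempty → ∃ v ∈ F, v ∈ T) := by
          intro A hA
          by_cases hL : Large A
          · exact ⟨∅, by simp, by simp, fun h => absurd hL h⟩
          · obtain ⟨T, h1, h2, h3⟩ := HasMatching.exists_cover (k := k)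
              (fun F hF => (Finset.card_le_card Finset.subset_union_left).trans (hkG n _ hF.2))
              (hn A hA hL)
            refine ⟨T, h1, fun v hv => ?_, fun _ => h3⟩
            obtain ⟨F, hF, hvF⟩ := h2 v hv
            simpa using hF.1 hvF
        choose! T hT using hT
        refine ⟨(Finset.range N).powerset.biUnion T, ?_, ?_, ?_⟩
        · exact Finset.card_biUnion_le.trans (Finset.sum_le_sum fun A hA => (hT A hA).1)
        · intro v hv
          obtain ⟨A, hA, hvA⟩ := Finset.mem_biUnion.1 hv
          exact (hT A hA).2.1 v hvA
        · intro _ A hA hL F hF hne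
          obtain ⟨v, hv, hvT⟩ := (hT A hA).2.2 hL F hF hne
          exact ⟨v, hv, Finset.mem_biUnion.2 ⟨A, hA, hvT⟩⟩
      · exact ⟨∅, by simp, by simp, fun h => absurd h hn⟩
    choose T hTc hTN hTQ using hcover
    choose τ hτ hτT using fun n => exists_perm_pack N (T n) (hTN n)
    refine ⟨N + M, fun n => τ n * σ n, fun n => (fun e => e.map (τ n).toEmbedding) '' Gs n,
      fun n => ?_, ?_⟩
    · beta_reduce
      rw [hGs n, Set.image_image]
      simp only [Finset.map_map]
      rfl
    filter_upwards [hev, hQ] with n hn hQn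
    rintro _ ⟨E, hE, rfl⟩ hEN
    have hle : Finset.range N ⊆ Finset.range (N + M) := Finset.range_mono (Nat.le_add_right _ _)
    have hEN' : ¬ E ⊆ Finset.range N := fun h => by
      simp only [map_eq_self_of_fixed (hτ n) h] at hEN
      exact hEN (h.trans hle)
    have hfix : ∀ A ⊆ E ∩ Finset.range N,
        A ⊆ E.map (τ n).toEmbedding ∩ Finset.range (N + M) := by
      intro A hA
      have hAN := hA.trans Finset.inter_subset_right
      refine Finset.subset_inter ?_ (hAN.trans hle)
      rw [← map_eq_self_of_fixed (hτ n) hAN]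
      exact Finset.map_subset_map.2 (hA.trans Finset.inter_subset_left)
    have hlarge : ∀ A ⊆ E ∩ Finset.range N, Large A →
        ∃ A ⊆ E.map (τ n).toEmbedding ∩ Finset.range (N + M), ∀ m, ∀ᶠ n' in U,
          HasMatching (linkAbove ((fun e => e.map (τ n').toEmbedding) '' Gs n') (N + M) A) m :=
      fun A hA hL => ⟨A, hfix A hA, fun m => (hL (m + (N + M))).mono fun n' h =>
        h.linkAbove_map (hτ n') (hA.trans Finset.inter_subset_right)⟩
    rcases hn E hE hEN' with ⟨A, hA, hL⟩ | hj
    · exact Or.inl (hlarge A hA hL)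
    by_cases hL : Large (E ∩ Finset.range N)
    · exact Or.inl (hlarge _ subset_rfl hL)
    right
    obtain ⟨v, hv, hvT⟩ := hTQ n hQn (E ∩ Finset.range N)
      (Finset.mem_powerset.2 Finset.inter_subset_right) hL (E \ Finset.range N)
      ⟨fun v hv => by simpa using (Finset.mem_sdiff.1 (Finset.mem_coe.1 hv)).2,
        by rwa [Finset.sdiff_union_inter]⟩
      (Finset.sdiff_nonempty.2 hEN')
    obtain ⟨hvE, hvN⟩ := Finset.mem_sdiff.1 hv
    have hτv : τ n v ∉ Finset.range N := fun h => by
      have h' := (τ n).injective (hτ n _ (Finset.mem_range.1 h))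
      exact hvN (h' ▸ h)
    have hsub : insert (τ n v) (E ∩ Finset.range N) ⊆
        E.map (τ n).toEmbedding ∩ Finset.range (N + M) := by
      refine Finset.insert_subset (Finset.mem_inter.2 ⟨?_, Finset.mem_range.2 ?_⟩)
        (hfix _ subset_rfl)
      · exact Finset.mem_map_of_mem _ hvE
      · exact (hτT n v hvT).trans_le (Nat.add_le_add_left (hTc n) N)
    refine le_trans ?_ (Finset.card_le_card hsub)
    rw [Finset.card_insert_of_notMem fun h => hτv (Finset.mem_inter.1 h).2]
    omega

/-- Proposition: given a sequence in `H_{k,p}` with positive infimum, one may realize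
it by countable hypergraphs on vertex set `ℕ` of rank at most `k`, and find a finite
"core" hypergraph `H₀` on a finite vertex set `V₀` and a subsequence along which
(a) the induced subhypergraph on `V₀` is `H₀`, and (b) every hyperedge leaving `V₀`
contains a subset `A ⊆ E ∩ V₀` whose neighbourhood hypergraph outside `V₀` contains a
matching of size at least `i`. -/
theorem stmt_5 (k : ℕ) (hk : 2 ≤ k) (p : ℝ) (hp0 : 0 < p) (hp1 : p < 1)
    (xs : ℕ → ℝ) (hxs : ∀ n, xs n ∈ HkSet k p)
    (x : ℝ) (hglb : IsGLB (Set.range xs) x) (hxpos : 0 < x) :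
    ∃ Hs : ℕ → HG,
      (∀ n, (Hs n).Valid ∧ (Hs n).verts = Set.univ ∧ (Hs n).RankLe k ∧
        (Hs n).idpLim p (xs n)) ∧
      ∃ H0 : FinHG, H0.Valid ∧
        ∃ ni : ℕ → ℕ, StrictMono ni ∧
          ∀ i : ℕ,
            ((H0.edges : Set (Finset ℕ)) =
                {e ∈ (Hs (ni i)).edges | e ⊆ H0.verts}) ∧
            ∀ E ∈ (Hs (ni i)).edges, ¬ E ⊆ H0.verts →
              ∃ A : Finset ℕ, A ⊆ E ∩ H0.verts ∧
                HasMatching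
                  {F : Finset ℕ | ↑F ⊆ ((H0.verts : Set ℕ))ᶜ ∧
                    F ∪ A ∈ (Hs (ni i)).edges} i := by
  classical
  choose H hV hR hid using hxs
  obtain ⟨N, σ, Gs, hGs, hev⟩ := exists_permutation_core k (hyperfilter ℕ) (fun n => (H n).edges)
    (fun n => hR n) (k + 1)
  let U := hyperfilter ℕ
  have hval : ∀ n, ((H n).permute (σ n)).Valid := fun n => HG.valid_permute (hV n) _
  have hrank : ∀ n, ((H n).permute (σ n)).RankLe k := fun n => HG.rankLe_permute (hR n) _
  have hGs' : ∀ n, Gs n = ((H n).permute (σ n)).edges := hGs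
  refine ⟨fun n => (H n).permute (σ n),
    fun n => ⟨hval n, rfl, hrank n, HG.idpLim_permute (hV n) (hid n) _⟩, ?_⟩
  simp only [← hGs']
  have hcore : ∃ S ∈ ((Finset.range N).powerset.powerset : Set (Finset (Finset ℕ))),
      ∀ᶠ n in U, (Finset.range N).powerset.filter (· ∈ Gs n) = S := by
    refine (Ultrafilter.eventually_exists_mem_iff (Finset.finite_toSet _)).1
      (Eventually.of_forall fun n => ⟨_, ?_, rfl⟩)
    exact Finset.mem_coe.2 (Finset.mem_powerset.2 (Finset.filter_subset _ _))
  obtain ⟨S, hS, hSev⟩ := hcore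
  have hlarge : ∀ i, ∀ᶠ n in U, ∀ A ∈ (Finset.range N).powerset,
      (∀ m, ∀ᶠ n' in U, HasMatching (linkAbove (Gs n') N A) m) →
        HasMatching (linkAbove (Gs n) N A) i := by
    refine fun i => (Filter.eventually_all_finset _).2 fun A _ => ?_
    by_cases hA : ∀ m, ∀ᶠ n' in U, HasMatching (linkAbove (Gs n') N A) m
    · exact (hA i).mono fun n hn _ => hn
    · exact Eventually.of_forall fun n h => absurd h hA
  refine ⟨⟨Finset.range N, S⟩, ?_, ?_⟩
  · intro e he
    obtain ⟨n, hn⟩ := hSev.exists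
    change e ∈ S at he
    rw [← hn] at he
    obtain ⟨he1, he2⟩ := Finset.mem_filter.1 he
    rw [hGs'] at he2
    exact ⟨(hval n e he2).1, Finset.mem_powerset.1 he1⟩
  · refine Filter.extraction_forall_of_frequently (P := fun i n =>
      ((S : Set (Finset ℕ)) = {e ∈ Gs n | e ⊆ Finset.range N}) ∧
        ∀ E ∈ Gs n, ¬ E ⊆ Finset.range N → ∃ A : Finset ℕ, A ⊆ E ∩ Finset.range N ∧
          HasMatching (linkAbove (Gs n) N A) i) fun i => ?_
    have hall : ∀ᶠ n in U, ((S : Set (Finset ℕ)) = {e ∈ Gs n | e ⊆ Finset.range N}) ∧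
        ∀ E ∈ Gs n, ¬ E ⊆ Finset.range N → ∃ A : Finset ℕ, A ⊆ E ∩ Finset.range N ∧
          HasMatching (linkAbove (Gs n) N A) i := by
      filter_upwards [hSev, hlarge i, hev] with n hn hli hE
      refine ⟨?_, fun E hEG hEN => ?_⟩
      · rw [← hn]
        ext e
        simp [and_comm]
      · rcases hE E hEG hEN with ⟨A, hA, hL⟩ | hcard
        · exact ⟨A, hA, hli A (Finset.mem_powerset.2 (hA.trans Finset.inter_subset_right)) hL⟩
        · have h1 := Finset.card_le_card (Finset.inter_subset_left (s₁ := E)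
            (s₂ := Finset.range N))
          rw [hGs'] at hEG
          have h2 := hrank n E hEG
          omega
    rw [← Nat.cofinite_eq_atTop]
    exact hall.frequently.filter_mono hyperfilter_le_cofinite
end
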